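/- arXiv:0908.1956 — 3 statements merged into one kernel-verified Lean document; each statement's English description precedes it below -/
import Mathlib

section
/- Cellular Matrix-Tree Theorem, part (1): Let d ≥ 1 and let X be a d-dimensional combinatorial cell structure that is APC. Then H_{d−2}(X) is finite, and π_d(X) · |H_{d−2}(X)|² = τ_d(X) · τ_{d−1}(X) (an equality of real numbers, with the natural numbers τ_d, τ_{d−1}, |H_{d−2}(X)| cast to ℝ; for d = 1 read H_{−1}(X) = ℤ/im ε, which is trivial since X_0 ≠ ∅). -/
open BigOperators Matrix

/-- A `d`-dimensional combinatorial cell structure: nonempty finite sets of `i`-cells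
(of sizes `c i`, with `c i = 0` for `i > d`) together with integer boundary matrices
`D i` (the matrix of `∂_{i+1}`), satisfying `∂ ∘ ∂ = 0` and the condition that every
column of `∂_1 = D 0` sums to zero. -/
structure CellStructure (d : ℕ) where
  c : ℕ → ℕ
  c_pos : ∀ i, i ≤ d → 0 < c i
  c_zero : ∀ i, d < i → c i = 0
  D : (i : ℕ) → Matrix (Fin (c i)) (Fin (c (i + 1))) ℤ
  dd : ∀ i, D i * D (i + 1) = 0
  colsum : ∀ j, ∑ i, D 0 i j = 0

namespace CellStructure

variable {d : ℕ} (X : CellStructure d)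

/-- The augmentation map `ε : ℤ^{X_0} → ℤ`. -/
def aug : (Fin (X.c 0) → ℤ) →ₗ[ℤ] ℤ where
  toFun v := ∑ i, v i
  map_add' u v := by simp [Finset.sum_add_distrib]
  map_smul' r v := by simp [Finset.mul_sum]

/-- The rational augmentation map. -/
def augQ : (Fin (X.c 0) → ℚ) →ₗ[ℚ] ℚ where
  toFun v := ∑ i, v i
  map_add' u v := by simp [Finset.sum_add_distrib]
  map_smul' r v := by simp [Finset.mul_sum]

/-- `bdry i` is the boundary map `∂_{i+1} : C_{i+1} → C_i`. -/
def bdry (i : ℕ) : (Fin (X.c (i + 1)) → ℤ) →ₗ[ℤ] (Fin (X.c i) → ℤ) :=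
  Matrix.toLin' (X.D i)

/-- Reduced cycles: `Zker i = ker ∂_i` (with `∂_0 = ε` the augmentation). -/
def Zker : (i : ℕ) → Submodule ℤ (Fin (X.c i) → ℤ)
  | 0 => LinearMap.ker X.aug
  | (i + 1) => LinearMap.ker (X.bdry i)

/-- Rational reduced cycles: kernel of `∂_i ⊗ ℚ`. -/
def ZkerQ : (i : ℕ) → Submodule ℚ (Fin (X.c i) → ℚ)
  | 0 => LinearMap.ker X.augQ
  | (i + 1) => LinearMap.ker (Matrix.toLin' ((X.D i).map (Int.cast : ℤ → ℚ)))

/-- Reduced homology `H_i(X) = ker ∂_i / im ∂_{i+1}` for `i ≥ 0`. -/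
abbrev H (i : ℕ) : Type :=
  X.Zker i ⧸ (LinearMap.range (X.bdry i)).comap (X.Zker i).subtype

/-- `Hred j` is the reduced homology in dimension `j - 1`; in particular
`Hred 0 = H_{-1}(X) = ℤ / im ε`. -/
def Hred : ℕ → Type
  | 0 => ℤ ⧸ LinearMap.range X.aug
  | (i + 1) => X.H i

/-- `β_i(X)`, the rank of the `i`-th reduced homology group. -/
noncomputable def beta (i : ℕ) : ℕ := Module.finrank ℤ (X.H i)

/-- `X` is acyclic in positive codimension. -/
def APC : Prop := ∀ i, i < d → X.beta i = 0

/-- The span of the columns of `∂_{j+1}` indexed by `T`. -/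
def colSpan (j : ℕ) (T : Finset (Fin (X.c (j + 1)))) : Submodule ℤ (Fin (X.c j) → ℤ) :=
  Submodule.span ℤ ((fun t => (X.D j)ᵀ t) '' (T : Set (Fin (X.c (j + 1)))))

/-- For `T ⊆ X_{j+1}`, the homology group `H_j(X_T)` of the subcomplex `X_T`. -/
abbrev Hsub (j : ℕ) (T : Finset (Fin (X.c (j + 1)))) : Type :=
  X.Zker j ⧸ (X.colSpan j T).comap (X.Zker j).subtype

/-- `HsubG k T` is `H_{k-1}(X_T)` for `T ⊆ X_k`; for `k = 0` this is
`H_{-1}(X_T) = ℤ / (ℤ-span of the entries of ε on T)` (all of which equal `1`). -/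
def HsubG : (k : ℕ) → Finset (Fin (X.c k)) → Type
  | 0, T => ℤ ⧸ Submodule.span ℤ ((fun _v => (1 : ℤ)) '' (T : Set (Fin (X.c 0))))
  | (j + 1), T => X.Hsub j T

/-- `T ⊆ X_{j+1}` is a cellular spanning `(j+1)`-tree of `X`. -/
def IsTree (j : ℕ) (T : Finset (Fin (X.c (j + 1)))) : Prop :=
  LinearIndependent ℤ (fun t : {f // f ∈ T} => (X.D j)ᵀ (t : Fin (X.c (j + 1))))
    ∧ Nat.card (X.Hsub j T) ≠ 0
    ∧ T.card = Module.finrank ℚ (X.ZkerQ j)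

/-- `IsTreeG k T` : `T ⊆ X_k` is a cellular spanning `k`-tree of `X`; a spanning
`0`-tree is a single vertex. -/
def IsTreeG : (k : ℕ) → Finset (Fin (X.c k)) → Prop
  | 0, T => LinearIndependent ℤ (fun _t : {f // f ∈ T} => (1 : ℤ))
      ∧ Nat.card (ℤ ⧸ Submodule.span ℤ ((fun _v => (1 : ℤ)) '' (T : Set (Fin (X.c 0))))) ≠ 0
      ∧ T.card = 1
  | (j + 1), T => X.IsTree j T

open Classical in
/-- The torsion-weighted spanning tree enumerators `τ_k(X)`, with `τ_0(X) = |X_0|`. -/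
noncomputable def tau : ℕ → ℕ
  | 0 => X.c 0
  | (j + 1) => ∑ T : Finset (Fin (X.c (j + 1))),
      if X.IsTree j T then (Nat.card (X.Hsub j T)) ^ 2 else 0

/-- The real boundary matrix of `∂_{i+1}`. -/
noncomputable def Dr (i : ℕ) : Matrix (Fin (X.c i)) (Fin (X.c (i + 1))) ℝ :=
  (X.D i).map (Int.cast : ℤ → ℝ)

/-- The up-down Laplacian `L^ud_i = ∂_{i+1} ∂_{i+1}^T` as a real matrix. -/
noncomputable def Lud (i : ℕ) : Matrix (Fin (X.c i)) (Fin (X.c i)) ℝ :=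
  X.Dr i * (X.Dr i)ᴴ

theorem Lud_isHermitian (i : ℕ) : (X.Lud i).IsHermitian :=
  Matrix.isHermitian_mul_conjTranspose_self _

/-- `π_k(X)`: the product of the nonzero eigenvalues of `L^ud_{k-1}` for `k ≥ 1`,
and `π_0(X) = |X_0|`. -/
noncomputable def piNZ : ℕ → ℝ
  | 0 => (X.c 0 : ℝ)
  | (j + 1) => ∏ i, (if (X.Lud_isHermitian j).eigenvalues i = 0 then 1
      else (X.Lud_isHermitian j).eigenvalues i)

end CellStructure

/-- The **Cauchy–Binet formula**. -/
theorem Matrix.det_mul_eq_sum_minors {n N R : Type*} [Fintype n] [DecidableEq n] [Fintype N]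
    [DecidableEq N] [CommRing R] (A : Matrix n N R) (B : Matrix N n R)
    (e : ∀ W : {W : Finset N // W.card = Fintype.card n}, n ≃ W.1) :
    (A * B).det = ∑ W, (A.submatrix id (fun i => (e W i : N))).det *
      (B.submatrix (fun i => (e W i : N)) id).det := by
  have expand : (A * B).det = ∑ p : n → N, (A.submatrix id p).det * ∏ i, B (p i) i := by
    simp only [det_apply', mul_apply, Finset.prod_univ_sum, Fintype.piFinset_univ, Finset.mul_sum,
      Finset.sum_mul]
    rw [Finset.sum_comm]
    refine Finset.sum_congr rfl fun p _ => Finset.sum_congr rfl fun σ _ => ?_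
    simp [Finset.prod_mul_distrib, mul_assoc]
  have group : ∑ p : n → N, (A.submatrix id p).det * ∏ i, B (p i) i =
      ∑ x : {W : Finset N // W.card = Fintype.card n} × Equiv.Perm n,
        (A.submatrix id (fun i => (e x.1 (x.2 i) : N))).det * ∏ i, B (e x.1 (x.2 i)) i := by
    symm
    refine Finset.sum_of_injOn (fun x i => (e x.1 (x.2 i) : N)) ?_ (by simp) ?_ (by simp)
    · rintro ⟨W, σ⟩ - ⟨W', σ'⟩ - h
      have key : ∀ (W : {W : Finset N // W.card = Fintype.card n}) (σ : Equiv.Perm n),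
          Set.range (fun i => (e W (σ i) : N)) = W.1 := by
        intro W σ
        ext y
        constructor
        · rintro ⟨i, rfl⟩
          exact (e W (σ i)).2
        · intro hy
          exact ⟨σ.symm ((e W).symm ⟨y, hy⟩), by simp⟩
      have hW : W = W' := by
        apply Subtype.ext
        apply Finset.coe_injective
        rw [← key W σ, ← key W' σ']
        exact congrArg Set.range h
      subst hW
      refine Prod.ext rfl (Equiv.ext fun i => ?_)
      exact (e W).injective (Subtype.ext (congrFun h i))
    · intro p _ hp
      have hp' : ¬ Function.Injective p := by
        intro hinj
        apply hp
        have hc : (Finset.univ.image p).card = Fintype.card n := by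
          rw [Finset.card_image_of_injective _ hinj, Finset.card_univ]
        let W : {W : Finset N // W.card = Fintype.card n} := ⟨Finset.univ.image p, hc⟩
        let f : n → n := fun i => (e W).symm ⟨p i, by simp [W]⟩
        have hf : Function.Injective f := fun i j hij =>
          hinj (congrArg Subtype.val ((e W).symm.injective hij))
        refine ⟨(W, Equiv.ofBijective f (Finite.injective_iff_bijective.mp hf)), by simp, ?_⟩
        ext i
        simp [f]
      obtain ⟨i, j, hij, hne⟩ := Function.not_injective_iff.mp hp'
      rw [det_zero_of_column_eq hne (fun k => by simp [hij]), zero_mul]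
  rw [expand, group, Fintype.sum_prod_type]
  refine Finset.sum_congr rfl fun W _ => ?_
  rw [det_apply' (B.submatrix _ id), Finset.mul_sum]
  refine Fintype.sum_equiv (Equiv.refl _) _ _ fun σ => ?_
  have h := det_permute' σ (A.submatrix id (fun i => (e W i : N)))
  rw [submatrix_submatrix] at h
  simp only [Function.comp_def, id] at h
  simp only [Function.id_def] at *
  rw [h]
  simp only [submatrix_apply, Equiv.refl_apply]
  ring

theorem finrank_eq_of_card_quotient_ne_zero {L : Type*} [AddCommGroup L] [Module.Finite ℤ L]
    (N : Submodule ℤ L) (h : Nat.card (L ⧸ N) ≠ 0) :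
    Module.finrank ℤ N = Module.finrank ℤ L := by
  have hfin : Finite (L ⧸ N) := Nat.finite_of_card_ne_zero h
  have : Module.finrank ℤ (L ⧸ N) = 0 := by
    rw [Module.finrank_eq_zero_iff_isTorsion]
    intro x
    refine ⟨⟨(Nat.card (L ⧸ N) : ℤ), by simpa using h⟩, ?_⟩
    simp [Submonoid.smul_def]
  have h2 := N.finrank_quotient_add_finrank
  omega

theorem linearIndependent_of_card_eq_finrank_of_finite_quotient {L ι : Type*} [AddCommGroup L]
    [Module.Finite ℤ L] [Fintype ι] (v : ι → L) (hc : Fintype.card ι = Module.finrank ℤ L)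
    (h : Nat.card (L ⧸ Submodule.span ℤ (Set.range v)) ≠ 0) : LinearIndependent ℤ v := by
  have h1 := finrank_eq_of_card_quotient_ne_zero _ h
  rw [linearIndependent_iff_injective_fintypeLinearCombination, ← LinearMap.ker_eq_bot]
  have h2 := (Fintype.linearCombination ℤ v).ker.finrank_quotient_add_finrank
  rw [(Fintype.linearCombination ℤ v).quotKerEquivRange.finrank_eq,
    Fintype.range_linearCombination, h1, Module.finrank_fintype_fun_eq_card, ← hc] at h2
  rw [← Submodule.finrank_eq_zero (R := ℤ)]
  omega

theorem Matrix.card_quotient_span_col {n : Type*} [Fintype n] [DecidableEq n]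
    (M : Matrix n n ℤ) :
    Nat.card ((n → ℤ) ⧸ Submodule.span ℤ (Set.range M.col)) = M.det.natAbs := by
  have hdet : (Pi.basisFun ℤ n).det M.col = M.det := by
    rw [Module.Basis.det_apply]
    congr 1
  by_cases h : LinearIndependent ℤ M.col
  · rw [← Submodule.natAbs_det_basis_change (Pi.basisFun ℤ n) _ (Module.Basis.span h), ← hdet]
    congr 2
    ext i : 1
    simp [Module.Basis.span_apply]
  · have h0 : M.det = 0 := by
      by_contra h0
      apply h
      rw [Fintype.linearIndependent_iff]
      intro g hg
      have : M *ᵥ g = 0 := by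
        rw [← hg]; ext i; simp [mulVec, dotProduct, mul_comm]
      exact fun i => congrFun (eq_zero_of_mulVec_eq_zero h0 this) i
    rw [h0, Int.natAbs_zero]
    by_contra hne
    exact h (linearIndependent_of_card_eq_finrank_of_finite_quotient _ (by simp) hne)

theorem Submodule.finrank_int_le_of_intCast_mem {ι K : Type*} [Fintype ι] [Field K] [CharZero K]
    (N : Submodule ℤ (ι → ℤ)) (N' : Submodule K (ι → K))
    (h : ∀ v ∈ N, (fun i => (v i : K)) ∈ N') : Module.finrank ℤ N ≤ Module.finrank K N' := by
  let b := Module.Free.chooseBasis ℤ N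
  have h1 : LinearIndependent ℤ (fun i => (b i : ι → ℤ)) :=
    b.linearIndependent.map' N.subtype (Submodule.ker_subtype N)
  have h2 := (linearIndependent_algebraMap_comp_iff (S := K)).mpr h1
  have h3 : LinearIndependent K
      (fun i => (⟨algebraMap ℤ K ∘ (b i : ι → ℤ), h _ (b i).2⟩ : N')) :=
    LinearIndependent.of_comp N'.subtype h2
  rw [Module.finrank_eq_card_basis b]
  exact h3.fintype_card_le_finrank

theorem Matrix.finrank_ker_range_map_intCast {n k K : Type*} [Fintype n] [Fintype k]
    [DecidableEq n] [Field K] [CharZero K] (M : Matrix k n ℤ) :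
    Module.finrank K (LinearMap.ker (Matrix.toLin' (M.map (Int.cast : ℤ → K)))) =
        Module.finrank ℤ (LinearMap.ker (Matrix.toLin' M)) ∧
      Module.finrank K (LinearMap.range (Matrix.toLin' (M.map (Int.cast : ℤ → K)))) =
        Module.finrank ℤ (LinearMap.range (Matrix.toLin' M)) := by
  have hmul : ∀ v : n → ℤ, (M.map (Int.cast : ℤ → K)) *ᵥ (fun i => (v i : K)) =
      fun i => ((M *ᵥ v) i : K) := by
    intro v; ext i; simp [mulVec, dotProduct]
  have hk := Submodule.finrank_int_le_of_intCast_mem (LinearMap.ker (Matrix.toLin' M))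
    (LinearMap.ker (Matrix.toLin' (M.map (Int.cast : ℤ → K)))) (by
      intro v hv
      rw [LinearMap.mem_ker, toLin'_apply] at hv ⊢
      rw [hmul, hv]; ext; simp)
  have hr := Submodule.finrank_int_le_of_intCast_mem (LinearMap.range (Matrix.toLin' M))
    (LinearMap.range (Matrix.toLin' (M.map (Int.cast : ℤ → K)))) (by
      rintro _ ⟨v, rfl⟩
      exact ⟨fun i => (v i : K), by rw [toLin'_apply, hmul]; rfl⟩)
  have h1 := (Matrix.toLin' (M.map (Int.cast : ℤ → K))).finrank_range_add_finrank_ker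
  have h2 := (LinearMap.ker (Matrix.toLin' M)).finrank_quotient_add_finrank
  rw [(Matrix.toLin' M).quotKerEquivRange.finrank_eq] at h2
  rw [Module.finrank_fintype_fun_eq_card] at h1 h2
  omega

theorem Submodule.card_quotient_sup_mul_card {G L : Type*} [AddCommGroup G] [AddCommGroup L]
    (A : G →ₗ[ℤ] L) (U V : Submodule ℤ G) (hU : U ≤ LinearMap.ker A)
    (hV : Nat.card (L ⧸ V.map A) ≠ 0 → Disjoint (LinearMap.ker A) V) :
    Nat.card (G ⧸ U ⊔ V) * Nat.card (L ⧸ LinearMap.range A) =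
      Nat.card (LinearMap.ker A ⧸ U.comap (LinearMap.ker A).subtype) *
        Nat.card (L ⧸ V.map A) := by
  set Z := LinearMap.ker A with hZ
  have hker : A.toAddMonoidHom.ker = Z.toAddSubgroup := rfl
  have h1 : Nat.card (G ⧸ U ⊔ V) = (U ⊔ V).toAddSubgroup.relIndex Z.toAddSubgroup *
      (Z ⊔ V).toAddSubgroup.index := by
    have hle : (U ⊔ V).toAddSubgroup ≤ (Z ⊔ V).toAddSubgroup := sup_le_sup_right hU V
    have heq : (Z ⊔ V).toAddSubgroup = Z.toAddSubgroup ⊔ (U ⊔ V).toAddSubgroup := by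
      rw [← Submodule.sup_toAddSubgroup, ← sup_assoc, sup_eq_left.mpr hU]
    rw [← AddSubgroup.relIndex_sup_right, ← heq, AddSubgroup.relIndex_mul_index hle]
    rfl
  have h2 : Nat.card (L ⧸ V.map A) =
      (Z ⊔ V).toAddSubgroup.index * Nat.card (L ⧸ LinearMap.range A) := by
    have := V.toAddSubgroup.index_map A.toAddMonoidHom
    rw [hker, ← Submodule.sup_toAddSubgroup, sup_comm] at this
    exact this
  rw [h1, mul_assoc, ← h2]
  by_cases h : Nat.card (L ⧸ V.map A) = 0
  · simp [h]
  · congr 1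
    rw [← AddSubgroup.inf_relIndex_right]
    have heq : (U ⊔ V).toAddSubgroup ⊓ Z.toAddSubgroup = U.toAddSubgroup := by
      change ((U ⊔ V) ⊓ Z).toAddSubgroup = _
      rw [sup_inf_assoc_of_le V hU, inf_comm, (hV h).eq_bot, sup_bot_eq]
    rw [heq]
    rfl

/-- The index of the lattice spanned by the columns of `B` in `W`, with value `0` if the index
is infinite. -/
noncomputable def Matrix.colIndex {n N : Type*} (B : Matrix n N ℤ) (W : Finset N) : ℕ :=
  Nat.card ((n → ℤ) ⧸ Submodule.span ℤ (B.col '' (W : Set N)))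

theorem Matrix.det_mul_diagonal_mul_transpose {n N R : Type*} [Fintype n] [DecidableEq n]
    [Fintype N] [DecidableEq N] [CommRing R] (B : Matrix n N ℤ) (w : N → R) :
    (B.map (Int.cast : ℤ → R) * diagonal w * (B.map (Int.cast : ℤ → R))ᵀ).det =
      ∑ W ∈ Finset.univ.powersetCard (Fintype.card n),
        (∏ i ∈ W, w i) * ((B.colIndex W : R)) ^ 2 := by
  have e : ∀ W : {W : Finset N // W.card = Fintype.card n}, n ≃ W.1 := fun W =>
    Fintype.equivOfCardEq (by rw [Fintype.card_coe, W.2])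
  rw [det_mul_eq_sum_minors _ _ e, Finset.powersetCard_eq_filter, Finset.powerset_univ,
    ← Finset.sum_subtype_eq_sum_filter, Finset.subtype_univ]
  refine Finset.sum_congr rfl fun W _ => ?_
  set M := B.submatrix id (fun i => (e W i : N)) with hM
  have hidx : (B.colIndex W : R) ^ 2 = (M.det : R) ^ 2 := by
    have hspan : B.col '' (W.1 : Set N) = Set.range M.col := by
      ext v
      constructor
      · rintro ⟨j, hj, rfl⟩
        exact ⟨(e W).symm ⟨j, hj⟩, by ext; simp [M]⟩
      · rintro ⟨i, rfl⟩
        exact ⟨e W i, (e W i).2, rfl⟩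
    rw [colIndex, hspan, card_quotient_span_col]
    have : ((M.det.natAbs : ℤ) : R) ^ 2 = (M.det : R) ^ 2 := by
      rw [← Int.cast_pow, Int.natAbs_sq, Int.cast_pow]
    simpa using this
  have hcast : (M.map (Int.cast : ℤ → R)).det = (M.det : R) :=
    ((Int.castRingHom R).map_det M).symm
  have h1 : (B.map (Int.cast : ℤ → R) * diagonal w).submatrix id (fun i => (e W i : N)) =
      M.map (Int.cast : ℤ → R) * diagonal (fun i => w (e W i)) := by
    ext i j; simp [M]
  have h2 : (B.map (Int.cast : ℤ → R))ᵀ.submatrix (fun i => (e W i : N)) id =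
      (M.map (Int.cast : ℤ → R))ᵀ := by
    ext i j; simp [M]
  rw [h1, h2, det_mul, det_transpose, det_diagonal, hcast, hidx,
    Fintype.prod_equiv (e W) (fun i => w (e W i)) (fun j => w j) (fun _ => rfl),
    Finset.prod_coe_sort W.1 w]
  ring

open Polynomial in
theorem Polynomial.coeff_prod_X_sub_C_card_zeros {n R : Type*} [Fintype n] [CommRing R]
    [DecidableEq R] (μ : n → R) :
    (∏ i, (X - C (μ i))).coeff (Finset.univ.filter fun i => μ i = 0).card =
      (-1) ^ (Finset.univ.filter fun i => μ i ≠ 0).card * ∏ i, if μ i = 0 then 1 else μ i := by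
  rw [← Finset.prod_filter_mul_prod_filter_not Finset.univ (fun i => μ i = 0)
    (fun i => X - C (μ i))]
  have h1 : ∏ i ∈ Finset.univ.filter (fun i => μ i = 0), (X - C (μ i)) =
      X ^ (Finset.univ.filter fun i => μ i = 0).card := by
    rw [← Finset.prod_const]
    refine Finset.prod_congr rfl fun i hi => ?_
    rw [(Finset.mem_filter.mp hi).2, C_0, sub_zero]
  rw [h1, coeff_X_pow_mul', if_pos le_rfl, Nat.sub_self, coeff_zero_eq_eval_zero, eval_prod,
    Finset.prod_ite, Finset.prod_const_one, one_mul, ← Finset.prod_const, ← Finset.prod_mul_distrib]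
  exact Finset.prod_congr rfl fun i _ => by simp

theorem Finset.sum_powersetCard_sum {n m R : Type*} [Fintype n] [Fintype m] [DecidableEq n]
    [DecidableEq m] [AddCommMonoid R] (k : ℕ) (F : Finset (n ⊕ m) → R) :
    ∑ W ∈ Finset.univ.powersetCard k, F W =
      ∑ S : Finset n, ∑ T : Finset m, if S.card + T.card = k then F (S.disjSum T) else 0 := by
  rw [Finset.powersetCard_eq_filter, Finset.powerset_univ, Finset.sum_filter,
    ← Fintype.sum_prod_type']
  refine Fintype.sum_equiv Finset.sumEquiv.toEquiv _ _ fun W => ?_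
  simp [Finset.toLeft_disjSum_toRight, Finset.card_toLeft_add_card_toRight]

open Polynomial in
theorem Matrix.prod_nonzero_eigenvalues_eq_sum_colIndex {n m : Type*} [Fintype n] [DecidableEq n]
    [Fintype m] [DecidableEq m] (D : Matrix n m ℤ)
    (hD : (D.map (Int.cast : ℤ → ℝ) * (D.map (Int.cast : ℤ → ℝ))ᴴ).IsHermitian) {s r : ℕ}
    (hr : r = Module.finrank ℤ (LinearMap.range (Matrix.toLin' D)))
    (hs : s + r = Fintype.card n) :
    ∏ i, (if hD.eigenvalues i = 0 then 1 else hD.eigenvalues i) =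
      ∑ S : Finset n, ∑ T : Finset m, if S.card = s ∧ T.card = r then
        ((fromCols 1 D).colIndex (S.disjSum T) : ℝ) ^ 2 else 0 := by
  classical
  set μ := hD.eigenvalues with hμ
  have hnz : (Finset.univ.filter fun i => μ i ≠ 0).card = r := by
    have h1 := hD.rank_eq_card_non_zero_eigs
    rw [rank_self_mul_conjTranspose, Fintype.card_subtype] at h1
    rw [hr, ← (finrank_ker_range_map_intCast (K := ℝ) D).2, ← h1]
    rfl
  have hz : (Finset.univ.filter fun i => μ i = 0).card = s := by
    have := Finset.card_filter_add_card_filter_not (s := (Finset.univ : Finset n))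
      (fun i => μ i = 0)
    rw [Finset.card_univ] at this
    have h2 : (Finset.univ.filter fun i => ¬ μ i = 0).card = r := hnz
    omega
  set B : Matrix n (n ⊕ m) ℤ := fromCols 1 D with hB
  set w : n ⊕ m → ℝ[X] := Sum.elim (fun _ => X) (fun _ => -1) with hw
  have hchar : (D.map (Int.cast : ℤ → ℝ) * (D.map (Int.cast : ℤ → ℝ))ᴴ).charmatrix =
      B.map (Int.cast : ℤ → ℝ[X]) * diagonal w * (B.map (Int.cast : ℤ → ℝ[X]))ᵀ := by
    ext1 i j
    rw [mul_apply, Fintype.sum_sum_type]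
    simp only [mul_diagonal]
    simp [charmatrix_apply, w, B, diagonal_apply, one_apply, mul_apply, sub_eq_add_neg]
  have hcoeff := coeff_prod_X_sub_C_card_zeros μ
  have hcp := hD.charpoly_eq
  rw [charpoly, hchar, det_mul_diagonal_mul_transpose, Finset.sum_powersetCard_sum] at hcp
  simp only [RCLike.ofReal_real_eq_id, id] at hcp
  rw [hz, hnz, ← hcp] at hcoeff
  have hsq : ((-1 : ℝ) ^ r) * (-1) ^ r = 1 := by rw [← mul_pow]; simp
  have hsolve : ∏ i, (if μ i = 0 then 1 else μ i) =
      (-1) ^ r * ((-1) ^ r * ∏ i, if μ i = 0 then 1 else μ i) := by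
    rw [← mul_assoc, hsq, one_mul]
  rw [hsolve, ← hcoeff, finsetSum_coeff, Finset.mul_sum]
  refine Finset.sum_congr rfl fun S _ => ?_
  rw [finsetSum_coeff, Finset.mul_sum]
  refine Finset.sum_congr rfl fun T _ => ?_
  have hprod : ∏ i ∈ S.disjSum T, w i = X ^ S.card * (-1) ^ T.card := by
    rw [Finset.prod_disjSum]; simp [w]
  rw [hprod]
  by_cases hST : S.card + T.card = Fintype.card n
  · rw [if_pos hST, mul_assoc, coeff_X_pow_mul']
    have hC : ((-1 : ℝ[X]) ^ T.card * (B.colIndex (S.disjSum T) : ℝ[X]) ^ 2) =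
        C ((-1 : ℝ) ^ T.card * (B.colIndex (S.disjSum T) : ℝ) ^ 2) := by simp
    rw [hC, coeff_C]
    by_cases hS : S.card = s
    · have hT : T.card = r := by omega
      rw [if_pos hS.le, if_pos (by omega), if_pos ⟨hS, hT⟩, hT, ← mul_assoc, hsq, one_mul]
    · have hneg : ¬(S.card = s ∧ T.card = r) := fun h => hS h.1
      rw [if_neg hneg]
      split_ifs <;> first | (exfalso; omega) | simp
  · rw [if_neg hST, if_neg (fun h => hST (by omega))]
    simp

theorem Matrix.colIndex_fromCols_one {n m : Type*} [Fintype n] [DecidableEq n]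
    [Fintype m] [DecidableEq m] (D : Matrix n m ℤ) {L : Type*} [AddCommGroup L] [Module.Finite ℤ L]
    (A : (n → ℤ) →ₗ[ℤ] L) (hAD : LinearMap.range (toLin' D) ≤ LinearMap.ker A)
    (S : Finset n) (T : Finset m) (hS : S.card = Module.finrank ℤ L) :
    (fromCols 1 D).colIndex (S.disjSum T) * Nat.card (L ⧸ LinearMap.range A) =
      Nat.card (LinearMap.ker A ⧸
        (Submodule.span ℤ (D.col '' (T : Set m))).comap (LinearMap.ker A).subtype) *
      Nat.card (L ⧸ Submodule.span ℤ ((fun i => A (Pi.single i 1)) '' (S : Set n))) := by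
  set U := Submodule.span ℤ (D.col '' (T : Set m)) with hU
  set V := Submodule.span ℤ ((fun i : n => (Pi.single i 1 : n → ℤ)) '' (S : Set n)) with hV
  have hUV : Submodule.span ℤ ((fromCols 1 D).col '' ((S.disjSum T : Finset (n ⊕ m)) :
      Set (n ⊕ m))) = U ⊔ V := by
    rw [hU, hV, ← Submodule.span_union, Set.union_comm]
    congr 1
    have h1 : ∀ i : n, (fromCols (1 : Matrix n n ℤ) D).col (Sum.inl i) = Pi.single i 1 := by
      intro i; ext k; simp [one_apply, Pi.single_apply]
    have h2 : ∀ j : m, (fromCols (1 : Matrix n n ℤ) D).col (Sum.inr j) = D.col j := by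
      intro j; ext k; simp
    ext v
    simp [h1, h2]
  have hVA : V.map A = Submodule.span ℤ ((fun i => A (Pi.single i 1)) '' (S : Set n)) := by
    rw [hV, Submodule.map_span, Set.image_image]
  have hUle : U ≤ LinearMap.ker A := by
    refine le_trans (Submodule.span_le.mpr ?_) hAD
    rintro _ ⟨j, -, rfl⟩
    exact ⟨Pi.single j 1, by simp⟩
  rw [colIndex, hUV, ← hVA]
  refine Submodule.card_quotient_sup_mul_card A U V hUle fun hne => ?_
  have hli : LinearIndependent ℤ (fun i : S => A (Pi.single (i : n) 1)) := by
    refine linearIndependent_of_card_eq_finrank_of_finite_quotient _ (by simpa using hS) ?_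
    rw [hVA] at hne
    convert hne using 5
    ext v; simp
  rw [Submodule.disjoint_def]
  intro v hv hvV
  have himg : (fun i : n => (Pi.single i 1 : n → ℤ)) '' (S : Set n) =
      Set.range (fun i : S => (Pi.single (i : n) 1 : n → ℤ)) := by
    ext v; simp
  rw [hV, himg, Submodule.mem_span_range_iff_exists_fun] at hvV
  obtain ⟨c, rfl⟩ := hvV
  rw [LinearMap.mem_ker, map_sum] at hv
  simp only [map_smul] at hv
  have hc := Fintype.linearIndependent_iff.mp hli c hv
  simp [hc]

/-- The cellular matrix-tree theorem for an integer matrix `D` and a map `A` killing its columns,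
with both homology groups finite. -/
theorem Matrix.prod_nonzero_eigenvalues_mul_card_sq {n m : Type*} [Fintype n] [DecidableEq n]
    [Fintype m] [DecidableEq m] (D : Matrix n m ℤ) {L : Type*} [AddCommGroup L]
    [Module.Finite ℤ L] (A : (n → ℤ) →ₗ[ℤ] L)
    (Z : Submodule ℤ (n → ℤ))
    (hker : LinearMap.ker A = Z) (hAD : LinearMap.range (toLin' D) ≤ Z)
    (hZ : Nat.card (Z ⧸
      (LinearMap.range (toLin' D)).comap Z.subtype) ≠ 0)
    (hL : Nat.card (L ⧸ LinearMap.range A) ≠ 0)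
    (hD : (D.map (Int.cast : ℤ → ℝ) * (D.map (Int.cast : ℤ → ℝ))ᴴ).IsHermitian) :
    (∏ i, (if hD.eigenvalues i = 0 then 1 else hD.eigenvalues i)) *
        (Nat.card (L ⧸ LinearMap.range A) : ℝ) ^ 2 =
      ((∑ T : Finset m, if T.card = Module.finrank ℤ Z then
        Nat.card (Z ⧸
          (Submodule.span ℤ (D.col '' (T : Set m))).comap Z.subtype) ^ 2
        else 0 : ℕ) : ℝ) *
      ((∑ S : Finset n, if S.card = Module.finrank ℤ L then
        Nat.card (L ⧸ Submodule.span ℤ ((fun i => A (Pi.single i 1)) '' (S : Set n))) ^ 2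
        else 0 : ℕ) : ℝ) := by
  subst hker
  have hr : Module.finrank ℤ (LinearMap.ker A) = Module.finrank ℤ (LinearMap.range (toLin' D)) := by
    rw [← finrank_eq_of_card_quotient_ne_zero _ hZ]
    exact (Submodule.comapSubtypeEquivOfLe hAD).finrank_eq
  have hs : Module.finrank ℤ L + Module.finrank ℤ (LinearMap.ker A) = Fintype.card n := by
    have h2 := (LinearMap.ker A).finrank_quotient_add_finrank
    rwa [A.quotKerEquivRange.finrank_eq, finrank_eq_of_card_quotient_ne_zero _ hL,
      Module.finrank_fintype_fun_eq_card] at h2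
  rw [prod_nonzero_eigenvalues_eq_sum_colIndex D hD hr hs, mul_comm (Nat.cast _) (Nat.cast _),
    ← Nat.cast_mul, Finset.sum_mul_sum, Finset.sum_mul]
  push_cast
  refine Finset.sum_congr rfl fun S _ => ?_
  rw [Finset.sum_mul]
  refine Finset.sum_congr rfl fun T _ => ?_
  by_cases hS : S.card = Module.finrank ℤ L
  · by_cases hT : T.card = Module.finrank ℤ (LinearMap.ker A)
    · have h := colIndex_fromCols_one D A hAD S T hS
      rw [if_pos ⟨hS, hT⟩, if_pos hS, if_pos hT, ← mul_pow, ← Nat.cast_mul, h, Nat.cast_mul]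
      ring
    · rw [if_neg (fun h => hT h.2), if_neg hT]
      simp
  · rw [if_neg (fun h => hS h.1), if_neg hS]
    simp

theorem Module.card_ne_zero_of_finrank_int_eq_zero {M : Type*} [AddCommGroup M]
    [Module.Finite ℤ M] (h : Module.finrank ℤ M = 0) : Nat.card M ≠ 0 := by
  have := Module.finite_of_fg_torsion M (Module.finrank_eq_zero_iff_isTorsion.mp h)
  exact Nat.card_ne_zero.mpr ⟨inferInstance, this⟩

namespace CellStructure

variable {d : ℕ} (X : CellStructure d)

theorem range_bdry_le_Zker (j : ℕ) : LinearMap.range (X.bdry j) ≤ X.Zker j := by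
  rintro _ ⟨v, rfl⟩
  cases j with
  | zero =>
    change ∑ i, (X.D 0 *ᵥ v) i = 0
    simp only [mulVec, dotProduct]
    rw [Finset.sum_comm]
    simp [← Finset.sum_mul, X.colsum]
  | succ j =>
    change X.D j *ᵥ (X.D (j + 1) *ᵥ v) = 0
    rw [mulVec_mulVec, X.dd, zero_mulVec]

theorem finrank_ZkerQ (j : ℕ) : Module.finrank ℚ (X.ZkerQ j) = Module.finrank ℤ (X.Zker j) := by
  cases j with
  | zero =>
    have h := (Matrix.finrank_ker_range_map_intCast (K := ℚ)
      (Matrix.of fun (_ : Unit) (_ : Fin (X.c 0)) => (1 : ℤ))).1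
    have h1 : X.ZkerQ 0 = LinearMap.ker (Matrix.toLin'
        ((Matrix.of fun (_ : Unit) (_ : Fin (X.c 0)) => (1 : ℤ)).map (Int.cast : ℤ → ℚ))) := by
      ext v
      simp [ZkerQ, augQ, funext_iff, mulVec, dotProduct]
    have h2 : X.Zker 0 = LinearMap.ker (Matrix.toLin'
        (Matrix.of fun (_ : Unit) (_ : Fin (X.c 0)) => (1 : ℤ))) := by
      ext v
      simp [Zker, aug, funext_iff, mulVec, dotProduct]
    rw [h1, h2, h]
  | succ j => exact (Matrix.finrank_ker_range_map_intCast (K := ℚ) (X.D j)).1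

theorem linearIndependent_of_card_eq_finrank {j : ℕ} {T : Finset (Fin (X.c (j + 1)))}
    (hT : T.card = Module.finrank ℤ (X.Zker j)) (h : Nat.card (X.Hsub j T) ≠ 0) :
    LinearIndependent ℤ (fun t : {f // f ∈ T} => (X.D j)ᵀ (t : Fin (X.c (j + 1)))) := by
  have hmem : ∀ t, (X.D j)ᵀ t ∈ X.Zker j := fun t =>
    X.range_bdry_le_Zker j ⟨Pi.single t 1, by simp [bdry]; rfl⟩
  let v : {f // f ∈ T} → X.Zker j := fun t => ⟨(X.D j)ᵀ t, hmem t⟩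
  have hspan : Submodule.span ℤ (Set.range v) = (X.colSpan j T).comap (X.Zker j).subtype := by
    rw [← Submodule.comap_map_eq_of_injective (X.Zker j).injective_subtype
      (Submodule.span ℤ (Set.range v)), Submodule.map_span, colSpan]
    congr 2
    ext w
    simp only [v, Submodule.subtype_apply, Set.mem_image, Set.mem_range, Subtype.exists,
      SetLike.mem_coe]
    aesop
  have hv : LinearIndependent ℤ v := by
    refine linearIndependent_of_card_eq_finrank_of_finite_quotient v (by simpa using hT) ?_
    rw [hspan]
    exact h
  exact hv.map' (X.Zker j).subtype (Submodule.ker_subtype _)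

theorem tau_succ (j : ℕ) : X.tau (j + 1) = ∑ T : Finset (Fin (X.c (j + 1))),
    if T.card = Module.finrank ℤ (X.Zker j) then (Nat.card (X.Hsub j T)) ^ 2 else 0 := by
  rw [tau]
  refine Finset.sum_congr rfl fun T _ => ?_
  by_cases hT : T.card = Module.finrank ℤ (X.Zker j)
  · rw [if_pos hT]
    by_cases h : Nat.card (X.Hsub j T) = 0
    · simp [h]
    · rw [if_pos ⟨X.linearIndependent_of_card_eq_finrank hT h, h, by rw [hT, finrank_ZkerQ]⟩]
  · rw [if_neg hT, if_neg fun h => hT (by rw [h.2.2, finrank_ZkerQ])]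

theorem card_H_ne_zero (hX : X.APC) {j : ℕ} (hj : j < d) : Nat.card (X.H j) ≠ 0 :=
  Module.card_ne_zero_of_finrank_int_eq_zero (hX j hj)

theorem aug_single (i : Fin (X.c 0)) : X.aug (Pi.single i 1) = 1 := by
  simp [aug]

theorem range_aug : LinearMap.range X.aug = ⊤ :=
  LinearMap.range_eq_top.mpr fun z =>
    ⟨z • Pi.single ⟨0, X.c_pos 0 (Nat.zero_le d)⟩ 1, by rw [map_smul, aug_single]; simp⟩

theorem tau_zero : X.tau 0 = ∑ S : Finset (Fin (X.c 0)), if S.card = Module.finrank ℤ ℤ then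
    Nat.card (ℤ ⧸ Submodule.span ℤ
      ((fun i => X.aug (Pi.single i 1)) '' (S : Set (Fin (X.c 0))))) ^ 2 else 0 := by
  have h : ∀ S : Finset (Fin (X.c 0)), (if S.card = Module.finrank ℤ ℤ then
      Nat.card (ℤ ⧸ Submodule.span ℤ
        ((fun i => X.aug (Pi.single i 1)) '' (S : Set (Fin (X.c 0))))) ^ 2 else 0) =
      if S.card = 1 then 1 else 0 := by
    intro S
    rw [Module.finrank_self]
    refine if_ctx_congr Iff.rfl (fun hS => ?_) fun _ => rfl
    obtain ⟨i, rfl⟩ := Finset.card_eq_one.mp hS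
    have : Submodule.span ℤ ({1} : Set ℤ) = ⊤ := Ideal.span_singleton_one
    simp [aug_single, this]
  simp_rw [h]
  rw [← Finset.sum_filter, ← Finset.powerset_univ, ← Finset.powersetCard_eq_filter]
  simp [tau]

end CellStructure

/-- **Cellular Matrix-Tree Theorem, part (1)** (Duval–Klivans–Martin).
Let `d = e + 1 ≥ 1` and let `X` be a `d`-dimensional combinatorial cell structure that is
APC.  Then `H_{d-2}(X)` is finite and
`π_d(X) · |H_{d-2}(X)|² = τ_d(X) · τ_{d-1}(X)` as real numbers. -/
theorem cellular_matrix_tree_theorem_part1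
    (e : ℕ) (X : CellStructure (e + 1)) (hAPC : X.APC) :
    Nat.card (X.Hred e) ≠ 0 ∧
      X.piNZ (e + 1) * (Nat.card (X.Hred e) : ℝ) ^ 2 =
        (X.tau (e + 1) : ℝ) * (X.tau e : ℝ) := by
  have hZ := X.card_H_ne_zero hAPC (Nat.lt_succ_self e)
  rw [X.tau_succ]
  cases e with
  | zero =>
    have hL : Nat.card (ℤ ⧸ LinearMap.range X.aug) ≠ 0 := by
      rw [X.range_aug]
      simp
    refine ⟨hL, ?_⟩
    rw [X.tau_zero]
    exact (X.D 0).prod_nonzero_eigenvalues_mul_card_sq X.aug (X.Zker 0) rfl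
      (X.range_bdry_le_Zker 0) hZ hL (X.Lud_isHermitian 0)
  | succ j =>
    have hL : Nat.card (X.H j) ≠ 0 := X.card_H_ne_zero hAPC (by omega)
    refine ⟨hL, ?_⟩
    let A := (X.bdry j).codRestrict (X.Zker j) fun v => X.range_bdry_le_Zker j ⟨v, rfl⟩
    have hrange : LinearMap.range A =
        (LinearMap.range (X.bdry j)).comap (X.Zker j).subtype :=
      LinearMap.range_codRestrict _ _ _
    have hspan : ∀ S : Finset (Fin (X.c (j + 1))),
        Submodule.span ℤ ((fun i => A (Pi.single i 1)) '' (S : Set (Fin (X.c (j + 1))))) =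
          (X.colSpan j S).comap (X.Zker j).subtype := by
      intro S
      rw [← Submodule.comap_map_eq_of_injective (X.Zker j).injective_subtype
        (Submodule.span ℤ _), Submodule.map_span, Set.image_image, CellStructure.colSpan]
      congr 3
      ext i : 1
      simp [A, CellStructure.bdry]
      rfl
    have h := (X.D (j + 1)).prod_nonzero_eigenvalues_mul_card_sq A (X.Zker (j + 1))
      (LinearMap.ker_codRestrict _ _ _) (X.range_bdry_le_Zker (j + 1)) hZ
      (by rw [hrange]; exact hL) (X.Lud_isHermitian (j + 1))
    simp only [hrange, hspan] at h
    rw [X.tau_succ]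
    exact h
end

section
/- Cellular Matrix-Tree Theorem, part (2): Let d ≥ 1, let X be a d-dimensional combinatorial cell structure that is APC, let U ⊆ X_{d−1} be the set of (d−1)-cells of a cellular spanning (d−1)-tree of X, and let L_U be the integer matrix obtained from L^ud_{d−1} = ∂_d ∂_d^T (over ℤ) by deleting the rows and columns indexed by U. Then H_{d−2}(X) and H_{d−2}(X_U) are finite and τ_d(X) · |H_{d−2}(X_U)|² = |H_{d−2}(X)|² · det L_U (an equality of integers; for d = 1, H_{−1}(X_U) = ℤ/(ℤ-span of the entries of ε on U)). -/
open BigOperators Matrix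

theorem Finset.exists_injective_image_univ_eq {n m : Type*} [Fintype n] [DecidableEq m]
    (T : Finset m) (hT : T.card = Fintype.card n) :
    ∃ g : n → m, Function.Injective g ∧ Finset.univ.image g = T := by
  let eqv : n ≃ T := Fintype.equivOfCardEq (by simp [hT])
  refine ⟨fun i => eqv i, Subtype.val_injective.comp eqv.injective, ?_⟩
  ext t
  simp only [Finset.mem_image, Finset.mem_univ, true_and]
  exact ⟨fun ⟨i, hi⟩ => hi ▸ (eqv i).2, fun ht => ⟨eqv.symm ⟨t, ht⟩, by simp⟩⟩

namespace Matrix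

variable {n m R : Type*} [Fintype n] [DecidableEq n] [Fintype m] [CommRing R]

theorem det_mul_eq_sum_prod_mul_det_submatrix (A : Matrix n m R) (B : Matrix m n R) :
    (A * B).det = ∑ f : n → m, (∏ i, A i (f i)) * (B.submatrix f id).det := by
  classical
  have hrow : A * B = fun i => ∑ k, A i k • B k := by
    ext i j
    simp [Matrix.mul_apply, Finset.sum_apply]
  rw [hrow]
  have h := (detRowAlternating (R := R) (n := n)).toMultilinearMap.map_sum
    (fun i (k : m) => A i k • B k)
  refine h.trans (Finset.sum_congr rfl fun f _ => ?_)
  exact (detRowAlternating (R := R) (n := n)).toMultilinearMap.map_smul_univ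
    (fun i => A i (f i)) (fun i => B (f i))

/-- The **Cauchy–Binet formula**, with the product of the two minors at a set `T` of columns of `A`
given as `F T`. -/
theorem det_mul_eq_sum_powersetCard [DecidableEq m] (A : Matrix n m R) (B : Matrix m n R)
    (F : Finset m → R)
    (hF : ∀ g : n → m, Function.Injective g →
      F (Finset.univ.image g) = (A.submatrix id g).det * (B.submatrix g id).det) :
    (A * B).det = ∑ T ∈ (Finset.univ : Finset m).powersetCard (Fintype.card n), F T := by
  classical
  rw [det_mul_eq_sum_prod_mul_det_submatrix,
    ← Finset.sum_subset (Finset.subset_univ (Finset.univ.filter Function.Injective)),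
    ← Finset.sum_fiberwise_of_maps_to (g := fun f : n → m => Finset.univ.image f)
      (t := (Finset.univ : Finset m).powersetCard (Fintype.card n))]
  · refine Finset.sum_congr rfl fun T hT => ?_
    have hT : T.card = Fintype.card n := (Finset.mem_powersetCard.1 hT).2
    obtain ⟨g, hinj, rfl⟩ := Finset.exists_injective_image_univ_eq T hT
    rw [hF g hinj, ← det_transpose, det_apply', Finset.sum_mul]
    symm
    refine Finset.sum_bij (fun (σ : Equiv.Perm n) _ => g ∘ σ) ?_ ?_ ?_ ?_
    · intro σ _
      simp only [Finset.mem_filter, Finset.mem_univ, true_and]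
      refine ⟨hinj.comp σ.injective, ?_⟩
      rw [← Finset.image_image, Finset.image_univ_equiv]
    · intro σ _ τ _ h
      ext i
      exact hinj (congrFun h i)
    · intro f hf
      simp only [Finset.mem_filter, Finset.mem_univ, true_and] at hf
      have hmem : ∀ i, ∃ j, g j = f i := fun i => by
        have : f i ∈ Finset.univ.image g := by
          rw [← hf.2]
          exact Finset.mem_image_of_mem f (Finset.mem_univ i)
        simpa using this
      choose s hs using hmem
      have hs_inj : Function.Injective s := fun i j hij => hf.1 (by rw [← hs, ← hs, hij])
      exact ⟨Equiv.ofBijective s (Finite.injective_iff_bijective.1 hs_inj), Finset.mem_univ _,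
        funext hs⟩
    · intro σ _
      have h := det_permute σ (B.submatrix g id)
      rw [submatrix_submatrix] at h
      simp only [Function.comp_id] at h
      simp only [h, transpose_apply, submatrix_apply, id, Function.comp_apply]
      ring
  · intro f hf
    simp only [Finset.mem_filter, Finset.mem_univ, true_and] at hf
    simp [Finset.mem_powersetCard, Finset.card_image_of_injective _ hf]
  · intro f _ hf
    simp only [Finset.mem_filter, Finset.mem_univ, true_and] at hf
    obtain ⟨i, j, hij, hne⟩ := Function.not_injective_iff.1 hf
    rw [det_zero_of_row_eq hne (by ext k; simp [hij]), mul_zero]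

/-- The index of the lattice spanned by the columns of a square integer matrix is the absolute
value of the determinant, where infinite index counts as `0`. -/
theorem index_range_toLin'_eq_natAbs_det (A : Matrix n n ℤ) :
    (LinearMap.range (toLin' A)).toAddSubgroup.index = A.det.natAbs := by
  by_cases hdet : A.det = 0
  · rw [hdet, Int.natAbs_zero]
    by_contra hindex
    set k := (LinearMap.range (toLin' A)).toAddSubgroup.index
    have hmem : ∀ j, ∃ v, A *ᵥ v = k • Pi.single j (1 : ℤ) := fun j => by
      simpa using AddSubgroup.nsmul_index_mem (LinearMap.range (toLin' A)).toAddSubgroup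
        (Pi.single j (1 : ℤ))
    choose v hv using hmem
    have hprod : A * (of v)ᵀ = (k : ℤ) • (1 : Matrix n n ℤ) := by
      ext i j
      have := congrFun (hv j) i
      simp only [mulVec, dotProduct] at this
      simp only [mul_apply, transpose_apply, of_apply, this]
      simp [one_apply, Pi.single_apply]
    have := congrArg det hprod
    rw [det_mul, hdet, zero_mul, det_smul, det_one, mul_one] at this
    exact pow_ne_zero _ (by exact_mod_cast hindex) this.symm
  · have hinj : Function.Injective (toLin' A) := mulVec_injective_of_det_ne_zero hdet
    have h := Submodule.natAbs_det_equiv (LinearMap.range (toLin' A))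
      (LinearEquiv.ofInjective (toLin' A) hinj)
    have heq : (LinearMap.range (toLin' A)).subtype ∘ₗ AddMonoidHom.toIntLinearMap
        ((LinearEquiv.ofInjective (toLin' A) hinj : _ →+ _)) = toLin' A := by
      ext; rfl
    rw [heq, LinearMap.det_toLin'] at h
    exact h.symm

end Matrix

theorem Submodule.natCard_quotient_comap_subtype {R M : Type*} [Ring R] [AddCommGroup M]
    [Module R M] (P Q : Submodule R M) :
    Nat.card (Q ⧸ P.comap Q.subtype) = P.toAddSubgroup.relIndex Q.toAddSubgroup :=
  rfl

/-- A homomorphism that is injective on `K` preserves relative indices in `K`. -/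
theorem AddSubgroup.relIndex_map_map_of_injOn {G G' : Type*} [AddGroup G] [AddGroup G']
    (f : G →+ G') {H K : AddSubgroup G} (hHK : H ≤ K) (hf : Set.InjOn f K) :
    (H.map f).relIndex (K.map f) = H.relIndex K := by
  have hinj : Function.Injective (f.comp K.subtype) := fun x y h => Subtype.ext (hf x.2 y.2 h)
  have h := AddSubgroup.relIndex_map_map_of_injective (H.addSubgroupOf K) ⊤ hinj
  rw [AddSubgroup.relIndex_top_right, ← AddSubgroup.map_map, ← AddSubgroup.map_map,
    AddSubgroup.map_addSubgroupOf_eq_of_le hHK] at h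
  rw [← AddMonoidHom.range_eq_map, AddSubgroup.range_subtype] at h
  exact h

theorem Submodule.relIndex_map_mul_index {R M N : Type*} [Ring R] [AddCommGroup M]
    [AddCommGroup N] [Module R M] [Module R N] (f : M →ₗ[R] N) {P Q : Submodule R M} (hPQ : P ≤ Q)
    (hf : Set.InjOn f Q) :
    P.toAddSubgroup.relIndex Q.toAddSubgroup * (Q.map f).toAddSubgroup.index =
      (P.map f).toAddSubgroup.index := by
  have hPQ' : P.toAddSubgroup ≤ Q.toAddSubgroup := hPQ
  rw [← AddSubgroup.relIndex_map_map_of_injOn f.toAddMonoidHom hPQ' hf]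
  exact AddSubgroup.relIndex_mul_index (AddSubgroup.map_mono hPQ')

section CoordinateProjection

variable {ι κ M : Type*} [AddCommGroup M] [Module ℤ M]

/-- The restriction of integer vectors to the coordinates outside of `U`. -/
def restrictCompl (U : Finset ι) : (ι → ℤ) →ₗ[ℤ] ({i // i ∉ U} → ℤ) :=
  LinearMap.funLeft ℤ ℤ Subtype.val

theorem restrictCompl_surjective (U : Finset ι) : Function.Surjective (restrictCompl U) :=
  LinearMap.funLeft_surjective_of_injective ℤ ℤ _ Subtype.val_injective

/-- Both sides are the index of `ker A + ℤ^U` in `ℤ^ι`. -/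
theorem relIndex_map_ker_restrictCompl (A : (ι → ℤ) →ₗ[ℤ] M) (U : Finset ι) :
    ((LinearMap.ker (restrictCompl U)).map A).toAddSubgroup.relIndex
        (LinearMap.range A).toAddSubgroup =
      ((LinearMap.ker A).map (restrictCompl U)).toAddSubgroup.index := by
  have h1 := AddSubgroup.relIndex_map_map A.toAddMonoidHom
    (LinearMap.ker (restrictCompl U)).toAddSubgroup ⊤
  have h2 := AddSubgroup.relIndex_map_map (restrictCompl U).toAddMonoidHom
    (LinearMap.ker A).toAddSubgroup ⊤
  rw [top_sup_eq, AddSubgroup.relIndex_top_right] at h1 h2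
  have e1 : (LinearMap.range A).toAddSubgroup =
      (⊤ : AddSubgroup (ι → ℤ)).map A.toAddMonoidHom :=
    AddMonoidHom.range_eq_map A.toAddMonoidHom
  have e2 : (⊤ : AddSubgroup (ι → ℤ)).map (restrictCompl U).toAddMonoidHom = ⊤ :=
    AddSubgroup.map_top_of_surjective _ (restrictCompl_surjective U)
  rw [e2, AddSubgroup.relIndex_top_right] at h2
  rw [e1]
  refine h1.trans (Eq.trans ?_ h2.symm)
  congr 1
  exact sup_comm _ _

variable [DecidableEq ι]

theorem eq_sum_single_of_mem_ker_restrictCompl {U : Finset ι} {v : ι → ℤ}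
    (hv : v ∈ LinearMap.ker (restrictCompl U)) :
    v = ∑ u : {i // i ∈ U}, v u • Pi.single (u : ι) (1 : ℤ) := by
  ext i
  rw [Finset.sum_coe_sort U (fun u => v u • Pi.single u (1 : ℤ)), Finset.sum_apply]
  by_cases hi : i ∈ U
  · rw [Finset.sum_eq_single_of_mem i hi]
    · simp
    · intro b _ hb
      simp [hb.symm]
  · have : v i = 0 := congrFun (LinearMap.mem_ker.1 hv) ⟨i, hi⟩
    rw [this, Finset.sum_eq_zero]
    intro b hb
    simp [show i ≠ b by rintro rfl; exact hi hb]

theorem ker_restrictCompl (U : Finset ι) :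
    LinearMap.ker (restrictCompl U) =
      Submodule.span ℤ ((fun u => Pi.single u (1 : ℤ)) '' (U : Set ι)) := by
  refine le_antisymm (fun v hv => ?_) (Submodule.span_le.2 ?_)
  · rw [eq_sum_single_of_mem_ker_restrictCompl hv]
    exact Submodule.sum_mem _ fun u _ =>
      Submodule.smul_mem _ _ (Submodule.subset_span ⟨u, u.2, rfl⟩)
  · rintro _ ⟨u, hu, rfl⟩
    refine LinearMap.mem_ker.2 (funext fun i => ?_)
    have : (i : ι) ≠ u := fun h => i.2 (h ▸ hu)
    simp [restrictCompl, LinearMap.funLeft_apply, this]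

variable (A : (ι → ℤ) →ₗ[ℤ] M) {U : Finset ι}

theorem injOn_restrictCompl_ker
    (hU : LinearIndependent ℤ fun u : {i // i ∈ U} => A (Pi.single (u : ι) 1)) :
    Set.InjOn (restrictCompl U) (LinearMap.ker A) := by
  intro x hx y hy hxy
  have hv : x - y ∈ LinearMap.ker (restrictCompl U) := by
    rw [LinearMap.mem_ker, map_sub, hxy, sub_self]
  have hA : A (x - y) = 0 := LinearMap.mem_ker.1 (sub_mem hx hy)
  have hsum := eq_sum_single_of_mem_ker_restrictCompl hv
  have hzero := Fintype.linearIndependent_iff.1 hU (fun u => (x - y) u) (by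
    rw [← hA]
    conv_rhs => rw [hsum]
    rw [map_sum]
    exact Finset.sum_congr rfl fun u _ => (A.map_smul _ _).symm)
  rw [← sub_eq_zero, hsum]
  exact Finset.sum_eq_zero fun u _ => by rw [hzero u, zero_smul]

variable [Fintype ι] {A} (B : Matrix ι κ ℤ)
  {T : Finset κ} {g : {i // i ∉ U} → κ}

theorem linearIndependent_cols_of_det_submatrix_ne_zero (hg : Set.range g = T)
    (hdet : (B.submatrix (Subtype.val : {i // i ∉ U} → ι) g).det ≠ 0) :
    LinearIndependent ℤ fun t : {t // t ∈ T} => Bᵀ t := by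
  have h := linearIndependent_cols_of_det_ne_zero hdet
  have hcomp : LinearIndependent ℤ (fun i => Bᵀ (g i)) :=
    LinearIndependent.of_comp (restrictCompl U) h
  have hpre : ∀ t : {t // t ∈ T}, ∃ i, g i = t := fun t => by
    have : (t : κ) ∈ Set.range g := hg ▸ t.2
    exact this
  choose s hs using hpre
  simpa only [Function.comp_def, hs] using
    hcomp.comp s fun x y hxy => Subtype.ext (by rw [← hs, ← hs, hxy])

theorem natAbs_det_submatrix_eq
    (hU : LinearIndependent ℤ fun u : {i // i ∈ U} => A (Pi.single (u : ι) 1))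
    (hAB : ∀ t, A (Bᵀ t) = 0) (hg : Set.range g = T) :
    (B.submatrix (Subtype.val : {i // i ∉ U} → ι) g).det.natAbs =
      (Submodule.span ℤ ((fun t => Bᵀ t) '' (T : Set κ))).toAddSubgroup.relIndex
          (LinearMap.ker A).toAddSubgroup *
        ((LinearMap.ker A).map (restrictCompl U)).toAddSubgroup.index := by
  set P := Submodule.span ℤ ((fun t => Bᵀ t) '' (T : Set κ)) with hP
  have hle : P ≤ LinearMap.ker A := by
    rw [hP, Submodule.span_le]
    rintro _ ⟨t, _, rfl⟩
    exact hAB t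
  have hrange : LinearMap.range
      (toLin' (B.submatrix (Subtype.val : {i // i ∉ U} → ι) g)) =
        P.map (restrictCompl U) := by
    rw [range_toLin', hP, Submodule.map_span, ← hg, ← Set.range_comp, ← Set.range_comp]
    rfl
  rw [← Matrix.index_range_toLin'_eq_natAbs_det, hrange,
    ← Submodule.relIndex_map_mul_index _ hle (injOn_restrictCompl_ker A hU)]

end CoordinateProjection

/-- The determinant of a reduced Laplacian as a sum over the sets of columns of the right size. -/
theorem det_submatrix_mul_transpose_eq_sum {ι κ M : Type*} [Fintype ι] [DecidableEq ι] [Fintype κ]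
    [DecidableEq κ] [AddCommGroup M] [Module ℤ M] {A : (ι → ℤ) →ₗ[ℤ] M} {U : Finset ι}
    (hU : LinearIndependent ℤ fun u : {i // i ∈ U} => A (Pi.single (u : ι) 1))
    {B : Matrix ι κ ℤ} (hAB : ∀ t, A (Bᵀ t) = 0) :
    ((B * Bᵀ).submatrix (Subtype.val : {i // i ∉ U} → ι) Subtype.val).det =
      ∑ T ∈ (Finset.univ : Finset κ).powersetCard (Fintype.card {i // i ∉ U}),
        ((Submodule.span ℤ ((fun t => Bᵀ t) '' (T : Set κ))).toAddSubgroup.relIndex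
            (LinearMap.ker A).toAddSubgroup : ℤ) ^ 2 *
          (((LinearMap.ker A).map (restrictCompl U)).toAddSubgroup.index : ℤ) ^ 2 := by
  have hmul : (B * Bᵀ).submatrix (Subtype.val : {i // i ∉ U} → ι) Subtype.val =
      B.submatrix (Subtype.val : {i // i ∉ U} → ι) id *
        (B.submatrix (Subtype.val : {i // i ∉ U} → ι) id)ᵀ := by
    ext i j
    simp [Matrix.mul_apply]
  rw [hmul]
  refine Matrix.det_mul_eq_sum_powersetCard _ _ _ fun g _ => ?_
  have h := natAbs_det_submatrix_eq B hU hAB (T := Finset.univ.image g) (g := g) (by simp)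
  rw [← mul_pow, ← Nat.cast_mul, ← h, Int.natCast_natAbs, sq_abs, ← Matrix.transpose_submatrix,
    Matrix.det_transpose, Matrix.submatrix_submatrix, sq]
  rfl

namespace CellStructure

variable {d : ℕ} (X : CellStructure d)

theorem tau_succ_mul_sq {M : Type*} [AddCommGroup M] [Module ℤ M] {e : ℕ} {U : Finset (Fin (X.c e))}
    {A : (Fin (X.c e) → ℤ) →ₗ[ℤ] M} (hker : LinearMap.ker A = X.Zker e)
    (hcol : ∀ t, A ((X.D e)ᵀ t) = 0)
    (hU : LinearIndependent ℤ fun u : {f // f ∈ U} => A (Pi.single (u : Fin (X.c e)) 1))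
    (hrank : Module.finrank ℚ (X.ZkerQ e) = Fintype.card {f // f ∉ U})
    {K : Submodule ℤ M} (hK : LinearMap.range A ≤ K)
    (hne : ((LinearMap.ker (restrictCompl U)).map A).toAddSubgroup.relIndex K.toAddSubgroup ≠ 0) :
    (LinearMap.range A).toAddSubgroup.relIndex K.toAddSubgroup ≠ 0 ∧
      (X.tau (e + 1) : ℤ) * (((LinearMap.ker (restrictCompl U)).map A).toAddSubgroup.relIndex
          K.toAddSubgroup : ℤ) ^ 2 =
        ((LinearMap.range A).toAddSubgroup.relIndex K.toAddSubgroup : ℤ) ^ 2 *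
          ((X.D e * (X.D e)ᵀ).submatrix (fun i : {f // f ∉ U} => i.1)
            (fun i : {f // f ∉ U} => i.1)).det := by
  classical
  have hmul := AddSubgroup.relIndex_mul_relIndex
    ((LinearMap.ker (restrictCompl U)).map A).toAddSubgroup (LinearMap.range A).toAddSubgroup
    K.toAddSubgroup (LinearMap.map_le_range (f := A)) hK
  rw [relIndex_map_ker_restrictCompl] at hmul
  rw [← hmul] at hne ⊢
  refine ⟨right_ne_zero_of_mul hne, ?_⟩
  have hq := left_ne_zero_of_mul hne
  have htree : ∀ T : Finset (Fin (X.c (e + 1))), X.IsTree e T ↔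
      T.card = Fintype.card {f // f ∉ U} ∧ Nat.card (X.Hsub e T) ≠ 0 := by
    intro T
    refine ⟨fun h => ⟨h.2.2.trans hrank, h.2.1⟩, fun h => ⟨?_, h.2, h.1.trans hrank.symm⟩⟩
    obtain ⟨hcard, hT⟩ := h
    obtain ⟨g, -, himg⟩ := Finset.exists_injective_image_univ_eq T hcard
    have hg : Set.range g = T := by rw [← himg, Finset.coe_image, Finset.coe_univ, Set.image_univ]
    refine linearIndependent_cols_of_det_submatrix_ne_zero (X.D e) hg ?_
    rw [← Int.natAbs_ne_zero, natAbs_det_submatrix_eq (X.D e) hU hcol hg, hker]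
    rw [hker] at hq
    exact mul_ne_zero hT hq
  have htau : (X.tau (e + 1) : ℤ) =
      ∑ T ∈ (Finset.univ : Finset (Fin (X.c (e + 1)))).powersetCard (Fintype.card {f // f ∉ U}),
        ((X.colSpan e T).toAddSubgroup.relIndex (LinearMap.ker A).toAddSubgroup : ℤ) ^ 2 := by
    rw [tau, Nat.cast_sum, Finset.powersetCard_eq_filter, Finset.powerset_univ, Finset.sum_filter]
    refine Finset.sum_congr rfl fun T _ => ?_
    simp only [htree T, hker, ← Submodule.natCard_quotient_comap_subtype]
    split_ifs with h1 h2 h2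
    · push_cast; rfl
    · exact absurd h1.1 h2
    · have hT : Nat.card (X.Hsub e T) = 0 := by_contra fun hT => h1 ⟨h2, hT⟩
      change (0 : ℕ) = (Nat.card (X.Hsub e T) : ℤ) ^ 2
      simp [hT]
    · rfl
  rw [det_submatrix_mul_transpose_eq_sum hU hcol, ← Finset.sum_mul, htau]
  push_cast
  simp only [colSpan]
  ring

theorem finrank_ZkerQ_zero : Module.finrank ℚ (X.ZkerQ 0) = X.c 0 - 1 := by
  have hsurj : Function.Surjective X.augQ := fun r =>
    ⟨Pi.single ⟨0, X.c_pos 0 (Nat.zero_le d)⟩ r, by simp [augQ]⟩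
  have h := X.augQ.finrank_range_add_finrank_ker
  rw [LinearMap.range_eq_top.2 hsurj, finrank_top, Module.finrank_self, Module.finrank_fin_fun] at h
  change Module.finrank ℚ (LinearMap.ker X.augQ) = _
  lia

theorem range_toLin'_map_D_le_ZkerQ (j : ℕ) :
    LinearMap.range (Matrix.toLin' ((X.D j).map (Int.cast : ℤ → ℚ))) ≤ X.ZkerQ j := by
  rintro _ ⟨v, rfl⟩
  cases j with
  | zero =>
    change ∑ i, ((X.D 0).map (Int.cast : ℤ → ℚ) *ᵥ v) i = 0
    simp only [Matrix.mulVec, dotProduct, Matrix.map_apply]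
    rw [Finset.sum_comm]
    refine Finset.sum_eq_zero fun j _ => ?_
    rw [← Finset.sum_mul, ← Int.cast_sum, X.colsum, Int.cast_zero, zero_mul]
  | succ j =>
    change ((X.D j).map (Int.cast : ℤ → ℚ)) *ᵥ (((X.D (j + 1)).map (Int.cast : ℤ → ℚ)) *ᵥ v) = 0
    have hmap : (X.D j).map (Int.cast : ℤ → ℚ) * (X.D (j + 1)).map (Int.cast : ℤ → ℚ) = 0 := by
      have h := Matrix.map_mul (L := X.D j) (M := X.D (j + 1)) (f := Int.castRingHom ℚ)
      rw [X.dd] at h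
      exact h.symm.trans (by simp)
    rw [Matrix.mulVec_mulVec, hmap, Matrix.zero_mulVec]

theorem IsTree.linearIndependent_rat {j : ℕ} {U : Finset (Fin (X.c (j + 1)))} (hU : X.IsTree j U) :
    LinearIndependent ℚ fun u : {f // f ∈ U} => ((X.D j).map (Int.cast : ℤ → ℚ))ᵀ u := by
  rw [← LinearIndependent.iff_fractionRing ℤ ℚ]
  let φ : (Fin (X.c j) → ℤ) →ₗ[ℤ] (Fin (X.c j) → ℚ) :=
    (Algebra.linearMap ℤ ℚ).compLeft (Fin (X.c j))
  have hφ : LinearMap.ker φ = ⊥ := LinearMap.ker_eq_bot.2 fun x y h => by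
    ext i
    exact Int.cast_injective (α := ℚ) (congrFun h i)
  exact hU.1.map' φ hφ

theorem IsTree.finrank_ZkerQ_succ {j : ℕ} {U : Finset (Fin (X.c (j + 1)))} (hU : X.IsTree j U) :
    Module.finrank ℚ (X.ZkerQ (j + 1)) = X.c (j + 1) - U.card := by
  set f := Matrix.toLin' ((X.D j).map (Int.cast : ℤ → ℚ)) with hf
  have hle : Module.finrank ℚ (LinearMap.range f) ≤ U.card :=
    hU.2.2 ▸ Submodule.finrank_mono (X.range_toLin'_map_D_le_ZkerQ j)
  have hge : U.card ≤ Module.finrank ℚ (LinearMap.range f) := by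
    have hspan := finrank_span_eq_card (IsTree.linearIndependent_rat X hU)
    rw [Fintype.card_coe] at hspan
    rw [← hspan]
    refine Submodule.finrank_mono (Submodule.span_le.2 ?_)
    rintro _ ⟨u, rfl⟩
    exact ⟨Pi.single u 1, by rw [hf, Matrix.toLin'_apply, Matrix.mulVec_single_one]; rfl⟩
  have h := f.finrank_range_add_finrank_ker
  rw [Module.finrank_fin_fun] at h
  change Module.finrank ℚ (LinearMap.ker f) = _
  lia

end CellStructure

/-- **Cellular Matrix-Tree Theorem, part (2)** (Duval–Klivans–Martin).
Let `d = e + 1 ≥ 1`, let `X` be a `d`-dimensional APC combinatorial cell structure, let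
`U ⊆ X_{d-1}` be the set of `(d-1)`-cells of a cellular spanning `(d-1)`-tree of `X`, and
let `L_U` be obtained from `L^ud_{d-1} = ∂_d ∂_d^T` (over `ℤ`) by deleting the rows and
columns indexed by `U`.  Then `H_{d-2}(X)` and `H_{d-2}(X_U)` are finite and
`τ_d(X) · |H_{d-2}(X_U)|² = |H_{d-2}(X)|² · det L_U` in `ℤ`. -/
theorem cellular_matrix_tree_theorem_part2
    (e : ℕ) (X : CellStructure (e + 1)) (hAPC : X.APC)
    (U : Finset (Fin (X.c e))) (hU : X.IsTreeG e U) :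
    Nat.card (X.Hred e) ≠ 0 ∧ Nat.card (X.HsubG e U) ≠ 0 ∧
      (X.tau (e + 1) : ℤ) * (Nat.card (X.HsubG e U) : ℤ) ^ 2 =
        (Nat.card (X.Hred e) : ℤ) ^ 2 *
          Matrix.det ((X.D e * (X.D e)ᵀ).submatrix
            (fun i : {f : Fin (X.c e) // f ∉ U} => i.1)
            (fun i : {f : Fin (X.c e) // f ∉ U} => i.1)) := by
  cases e with
  | zero =>
    have haug : ∀ u, X.aug (Pi.single u 1) = 1 := fun u => by simp [CellStructure.aug]
    have hmap : (LinearMap.ker (restrictCompl U)).map X.aug =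
        Submodule.span ℤ ((fun _ => (1 : ℤ)) '' (U : Set (Fin (X.c 0)))) := by
      rw [ker_restrictCompl, Submodule.map_span, Set.image_image]
      simp only [haug]
    have hsub : Nat.card (X.HsubG 0 U) =
        ((LinearMap.ker (restrictCompl U)).map X.aug).toAddSubgroup.relIndex
          (⊤ : Submodule ℤ ℤ).toAddSubgroup := by
      rw [hmap]
      exact (AddSubgroup.relIndex_top_right _).symm
    have hred : Nat.card (X.Hred 0) = (LinearMap.range X.aug).toAddSubgroup.relIndex
        (⊤ : Submodule ℤ ℤ).toAddSubgroup := (AddSubgroup.relIndex_top_right _).symm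
    have hne : Nat.card (X.HsubG 0 U) ≠ 0 := hU.2.1
    rw [hred, and_left_comm]
    refine ⟨hne, ?_⟩
    rw [hsub] at hne ⊢
    refine X.tau_succ_mul_sq rfl X.colsum ?_ ?_ le_top hne
    · simpa only [haug] using hU.1
    · rw [X.finrank_ZkerQ_zero]
      simp [hU.2.2]
  | succ j =>
    have hbdry : ∀ u, X.bdry j (Pi.single u 1) = (X.D j)ᵀ u := fun u => by
      rw [CellStructure.bdry, Matrix.toLin'_apply, Matrix.mulVec_single_one]
      rfl
    have hmap : (LinearMap.ker (restrictCompl U)).map (X.bdry j) = X.colSpan j U := by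
      rw [ker_restrictCompl, Submodule.map_span, Set.image_image]
      simp only [hbdry]
      rfl
    have hsub : Nat.card (X.HsubG (j + 1) U) =
        ((LinearMap.ker (restrictCompl U)).map (X.bdry j)).toAddSubgroup.relIndex
          (X.Zker j).toAddSubgroup := by
      rw [hmap]
      exact Submodule.natCard_quotient_comap_subtype _ _
    have hred : Nat.card (X.Hred (j + 1)) =
        (LinearMap.range (X.bdry j)).toAddSubgroup.relIndex (X.Zker j).toAddSubgroup :=
      Submodule.natCard_quotient_comap_subtype _ _
    have hne : Nat.card (X.HsubG (j + 1) U) ≠ 0 := hU.2.1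
    rw [hred, and_left_comm]
    refine ⟨hne, ?_⟩
    rw [hsub] at hne ⊢
    refine X.tau_succ_mul_sq rfl ?_ ?_ ?_ ?_ hne
    · intro t
      ext i
      exact congrFun (congrFun (X.dd j) i) t
    · simpa only [hbdry] using hU.1
    · rw [CellStructure.IsTree.finrank_ZkerQ_succ X hU]
      simp
    · rintro _ ⟨v, rfl⟩
      cases j with
      | zero =>
        change ∑ i, (X.D 0 *ᵥ v) i = 0
        simp only [Matrix.mulVec, dotProduct]
        rw [Finset.sum_comm]
        exact Finset.sum_eq_zero fun t _ => by rw [← Finset.sum_mul, X.colsum, zero_mul]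
      | succ j =>
        change X.D j *ᵥ (X.D (j + 1) *ᵥ v) = 0
        rw [Matrix.mulVec_mulVec, X.dd, Matrix.zero_mulVec]
end

section
/- Weighted Cellular Matrix-Tree Theorem, part (2): Let d ≥ 1, let X be a d-dimensional combinatorial cell structure that is APC, and let R, ∂̂_d, L̂ = ∂̂_d ∂̂_d^T and τ̂_d(X) be as in the weighted setting. Let U ⊆ X_{d−1} be the set of (d−1)-cells of a cellular spanning (d−1)-tree of X, and let L̂_U be obtained from L̂ by deleting the rows and columns indexed by U. Then τ̂_d(X) · |H_{d−2}(X_U)|² = |H_{d−2}(X)|² · det L̂_U, an equality in the polynomial ring R = ℤ[x_f : f ∈ X_d]. -/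
open BigOperators Matrix

namespace CellStructure

variable {e : ℕ} (X : CellStructure (e + 1))

/-- The weighted boundary matrix `∂̂_d` over `R = ℤ[x_f : f ∈ X_d]`: the column of each
`d`-cell `f` is multiplied by the indeterminate `x_f`. -/
noncomputable def wD :
    Matrix (Fin (X.c e)) (Fin (X.c (e + 1))) (MvPolynomial (Fin (X.c (e + 1))) ℤ) :=
  Matrix.of fun i f => (X.D e i f : MvPolynomial (Fin (X.c (e + 1))) ℤ) * MvPolynomial.X f

/-- The weighted up-down Laplacian `L̂ = ∂̂_d ∂̂_d^T`. -/
noncomputable def wLud :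
    Matrix (Fin (X.c e)) (Fin (X.c e)) (MvPolynomial (Fin (X.c (e + 1))) ℤ) :=
  X.wD * (X.wD)ᵀ

open Classical in
/-- The weighted spanning tree enumerator
`τ̂_d(X) = Σ_{T a spanning d-tree} |H_{d-1}(X_T)|² ∏_{f ∈ T} x_f²`. -/
noncomputable def wtau : MvPolynomial (Fin (X.c (e + 1))) ℤ :=
  ∑ T : Finset (Fin (X.c (e + 1))),
    if X.IsTree e T then
      (Nat.card (X.Hsub e T) : MvPolynomial (Fin (X.c (e + 1))) ℤ) ^ 2 *
        ∏ f ∈ T, (MvPolynomial.X f) ^ 2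
    else 0

end CellStructure

theorem Matrix.det_mul_eq_sum_det_submatrix {R m n : Type*} [CommRing R] [Fintype m]
    [DecidableEq m] [Fintype n] [DecidableEq n] (A : Matrix m n R) (B : Matrix n m R)
    (g : ∀ T : {T : Finset n // T.card = Fintype.card m}, m ≃ {f // f ∈ T.1}) :
    (A * B).det = ∑ T : {T : Finset n // T.card = Fintype.card m},
      (A.submatrix id fun i => (g T i : n)).det *
        (B.submatrix (fun i => (g T i : n)) id).det := by
  have expand : (A * B).det = ∑ f : m → n, (∏ i, B (f i) i) * (A.submatrix id f).det := by
    have hrow : (A * B)ᵀ = fun j => ∑ k, B k j • Aᵀ k := by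
      ext j i
      simp [Matrix.mul_apply, Finset.sum_apply, mul_comm]
    rw [← Matrix.det_transpose, hrow]
    change Matrix.detRowAlternating.toMultilinearMap (fun j => ∑ k, B k j • Aᵀ k) = _
    rw [MultilinearMap.map_sum]
    refine Finset.sum_congr rfl fun f _ => ?_
    rw [MultilinearMap.map_smul_univ, smul_eq_mul, ← Matrix.det_transpose (A.submatrix id f)]
    rfl
  rw [expand]
  have key : ∀ T : {T : Finset n // T.card = Fintype.card m},
      (A.submatrix id fun i => (g T i : n)).det *
        (B.submatrix (fun i => (g T i : n)) id).det =
      ∑ σ : Equiv.Perm m, (∏ i, B (g T (σ i)) i) *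
        (A.submatrix id fun i => (g T (σ i) : n)).det := by
    intro T
    rw [Matrix.det_apply' (B.submatrix _ id), Finset.mul_sum]
    refine Finset.sum_congr rfl fun σ _ => ?_
    have := Matrix.det_permute' σ (A.submatrix id fun i => (g T i : n))
    rw [Matrix.submatrix_submatrix] at this
    change (A.submatrix id fun i => (g T (σ i) : n)).det = _ at this
    rw [this]
    simp only [Matrix.submatrix_apply, id]
    ring
  simp_rw [key]
  rw [← Fintype.sum_sigma'
    (f := fun (T : {T : Finset n // T.card = Fintype.card m}) (σ : Equiv.Perm m) =>
      (∏ i, B (g T (σ i)) i) * (A.submatrix id fun i => (g T (σ i) : n)).det)]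
  symm
  refine Finset.sum_of_injOn (fun p i => (g p.1 (p.2 i) : n)) ?_ (by simp) ?_ (by simp)
  · rintro ⟨T, σ⟩ - ⟨T', σ'⟩ - h
    have h : ∀ i, (g T (σ i) : n) = g T' (σ' i) := fun i => congrFun h i
    have hT : T = T' := by
      ext x
      constructor
      · intro hx
        obtain ⟨i, hi⟩ := ((σ.trans (g T))).surjective ⟨x, hx⟩
        have : (g T (σ i) : n) = x := congrArg Subtype.val hi
        rw [← this, h]
        exact (g T' (σ' i)).2
      · intro hx
        obtain ⟨i, hi⟩ := ((σ'.trans (g T'))).surjective ⟨x, hx⟩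
        have : (g T' (σ' i) : n) = x := congrArg Subtype.val hi
        rw [← this, ← h]
        exact (g T (σ i)).2
    subst hT
    congr
    ext i
    exact (g T).injective (Subtype.ext (h i))
  · intro f _ hf
    by_cases hinj : Function.Injective f
    · refine absurd ?_ hf
      let T : {T : Finset n // T.card = Fintype.card m} :=
        ⟨Finset.univ.image f, by rw [Finset.card_image_of_injective _ hinj, Finset.card_univ]⟩
      let h : m → {x // x ∈ T.1} := fun i => ⟨f i, by simp [T]⟩
      have hh : Function.Injective fun i => (g T).symm (h i) := fun i j hij =>
        hinj (congrArg Subtype.val ((g T).symm.injective hij))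
      refine ⟨⟨T, Equiv.ofBijective _ (Finite.injective_iff_bijective.1 hh)⟩, by simp, ?_⟩
      ext i
      simp [h]
    · obtain ⟨i, j, hij, hne⟩ : ∃ i j, f i = f j ∧ i ≠ j := by
        simpa [Function.Injective] using hinj
      rw [Matrix.det_zero_of_column_eq hne (fun k => by simp [hij]), mul_zero]

theorem Matrix.index_range_toLin' {n : Type*} [Fintype n] [DecidableEq n] (M : Matrix n n ℤ) :
    (LinearMap.range (Matrix.toLin' M)).toAddSubgroup.index = M.det.natAbs := by
  by_cases hM : M.det = 0
  · rw [hM, Int.natAbs_zero]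
    by_contra hk
    set k := (LinearMap.range (Matrix.toLin' M)).toAddSubgroup.index with hkdef
    have hmem : ∀ j, ∃ v, M *ᵥ v = Pi.single j (k : ℤ) := by
      intro j
      have := AddSubgroup.nsmul_index_mem
        (LinearMap.range (Matrix.toLin' M)).toAddSubgroup (Pi.single j (1 : ℤ))
      obtain ⟨v, hv⟩ := this
      refine ⟨v, ?_⟩
      rw [Matrix.toLin'_apply] at hv
      rw [hv, ← Pi.single_smul]
      simp [← hkdef]
    choose v hv using hmem
    have hmul : M * (Matrix.of v)ᵀ = (k : ℤ) • (1 : Matrix n n ℤ) := by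
      ext i j
      have := congrFun (hv j) i
      rw [Matrix.mul_apply, Matrix.smul_apply, Matrix.one_apply]
      simpa [Matrix.mulVec, dotProduct, Pi.single_apply] using this
    have hdet := congrArg Matrix.det hmul
    rw [Matrix.det_mul, hM, zero_mul, Matrix.det_smul, Matrix.det_one, mul_one] at hdet
    exact hk (by exact_mod_cast eq_zero_of_pow_eq_zero hdet.symm)
  · have hinj : Function.Injective (Matrix.toLin' M) :=
      Matrix.mulVec_injective_iff.2 (Matrix.linearIndependent_cols_of_det_ne_zero hM)
    have := Submodule.natAbs_det_equiv (LinearMap.range (Matrix.toLin' M))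
      (LinearEquiv.ofInjective _ hinj)
    have hcomp : (LinearMap.range (Matrix.toLin' M)).subtype ∘ₗ
        AddMonoidHom.toIntLinearMap ((LinearEquiv.ofInjective (Matrix.toLin' M) hinj :
          (n → ℤ) ≃ₗ[ℤ] _) : (n → ℤ) →+ _) = Matrix.toLin' M := by
      ext; rfl
    rw [hcomp, LinearMap.det_toLin'] at this
    exact this.symm

theorem AddSubgroup.index_map_mul_index_range {G H K : Type*} [AddCommGroup G] [AddCommGroup H]
    [AddCommGroup K] (π : G →+ H) (hπ : Function.Surjective π) (φ : G →+ K)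
    (hdisj : Disjoint φ.ker π.ker) (C : AddSubgroup G) (hC : C ≤ φ.ker) :
    (C.map π).index * φ.range.index = C.relIndex φ.ker * (π.ker.map φ).index := by
  have h₁ : (C.map π).relIndex (φ.ker.map π) = C.relIndex φ.ker := by
    rw [← AddSubgroup.relIndex_comap, AddSubgroup.comap_map_eq, ← AddSubgroup.inf_relIndex_right,
      sup_inf_assoc_of_le _ hC, inf_comm, hdisj.eq_bot, sup_bot_eq]
  have h₂ : (φ.ker.map π).index = (π.ker ⊔ φ.ker).index := by
    rw [← AddSubgroup.index_comap_of_surjective _ hπ, AddSubgroup.comap_map_eq, sup_comm]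
  rw [AddSubgroup.index_map π.ker φ, ← h₂, ← h₁,
    ← AddSubgroup.relIndex_mul_index (AddSubgroup.map_mono hC), mul_assoc]

theorem finrank_ker_eq_card_compl {n N : Type*} [Fintype n] [DecidableEq n] [AddCommGroup N]
    [Module ℚ N] (ψ : (n → ℚ) →ₗ[ℚ] N) (U : Finset n)
    (hli : LinearIndependent ℤ fun t : {j // j ∈ U} => ψ (Pi.single t.1 1))
    (hspan : ∀ j, ∃ k : ℕ, k ≠ 0 ∧
      k • ψ (Pi.single j 1) ∈ Submodule.span ℤ ((fun j => ψ (Pi.single j 1)) '' (U : Set n))) :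
    Module.finrank ℚ (LinearMap.ker ψ) = Fintype.card {j // j ∉ U} := by
  have hliQ := (LinearIndependent.iff_fractionRing ℤ ℚ).1 hli
  have hrange : LinearMap.range ψ =
      Submodule.span ℚ (Set.range fun t : {j // j ∈ U} => ψ (Pi.single t.1 1)) := by
    apply le_antisymm
    · rw [← Submodule.map_top, ← (Pi.basisFun ℚ n).span_eq, Submodule.map_span,
        Submodule.span_le]
      rintro _ ⟨_, ⟨j, rfl⟩, rfl⟩
      obtain ⟨k, hk, hmem⟩ := hspan j
      rw [Pi.basisFun_apply, SetLike.mem_coe]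
      have himg : ((fun j => ψ (Pi.single j 1)) '' (U : Set n)) =
          Set.range fun t : {j // j ∈ U} => ψ (Pi.single t.1 1) := by
        ext x; simp
      rw [himg] at hmem
      have hmemQ := Submodule.span_le_restrictScalars ℤ ℚ _ hmem
      rw [Submodule.restrictScalars_mem, ← Nat.cast_smul_eq_nsmul ℚ] at hmemQ
      exact (Submodule.smul_mem_iff _ (by exact_mod_cast hk)).1 hmemQ
    · rw [Submodule.span_le]
      rintro _ ⟨t, rfl⟩
      exact ⟨_, rfl⟩
  have hfin := LinearMap.finrank_range_add_finrank_ker ψ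
  rw [hrange, finrank_span_eq_card hliQ, Module.finrank_fintype_fun_eq_card] at hfin
  have := Fintype.card_subtype_compl (fun j => j ∈ U)
  omega

namespace CellStructure

theorem bdry_mem_Zker {d : ℕ} (X : CellStructure d) (j : ℕ) (v : Fin (X.c (j + 1)) → ℤ) :
    X.bdry j v ∈ X.Zker j := by
  cases j with
  | zero =>
    have : X.aug ∘ₗ X.bdry 0 = 0 := LinearMap.pi_ext' fun j => LinearMap.ext_ring (by
      simpa [aug, bdry] using X.colsum j)
    exact LinearMap.congr_fun this v
  | succ k =>
    have : X.bdry k ∘ₗ X.bdry (k + 1) = 0 := by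
      rw [bdry, bdry, ← Matrix.toLin'_mul, X.dd, map_zero]
    exact LinearMap.congr_fun this v

theorem bdry_single {d : ℕ} (X : CellStructure d) (j : ℕ) (t : Fin (X.c (j + 1))) :
    X.bdry j (Pi.single t 1) = (X.D j)ᵀ t := by
  ext i
  simp [bdry]

theorem colSpan_le_Zker {d : ℕ} (X : CellStructure d) (j : ℕ)
    (T : Finset (Fin (X.c (j + 1)))) : X.colSpan j T ≤ X.Zker j := by
  rw [colSpan, Submodule.span_le]
  rintro _ ⟨t, -, rfl⟩
  have := X.bdry_mem_Zker j (Pi.single t 1)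
  rwa [bdry_single] at this

theorem map_colSpan_funLeft {d : ℕ} (X : CellStructure d) (j : ℕ) {S : Type*} [Fintype S]
    [DecidableEq S] (r : S → Fin (X.c j)) (T : Finset (Fin (X.c (j + 1))))
    (g : S ≃ {f // f ∈ T}) :
    (X.colSpan j T).map (LinearMap.funLeft ℤ ℤ r) =
      LinearMap.range (Matrix.toLin' ((X.D j).submatrix r fun i => (g i).1)) := by
  rw [Matrix.toLin'_apply', Matrix.range_mulVecLin, colSpan, Submodule.map_span]
  congr 1
  ext v
  constructor
  · rintro ⟨_, ⟨t, ht, rfl⟩, rfl⟩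
    exact ⟨g.symm ⟨t, ht⟩, by ext; simp [LinearMap.funLeft_apply]⟩
  · rintro ⟨i, rfl⟩
    exact ⟨_, ⟨g i, (g i).2, rfl⟩, rfl⟩

theorem card_Hsub_eq_relIndex {d : ℕ} (X : CellStructure d) (j : ℕ)
    (T : Finset (Fin (X.c (j + 1)))) :
    Nat.card (X.Hsub j T) = (X.colSpan j T).toAddSubgroup.relIndex (X.Zker j).toAddSubgroup :=
  rfl

theorem linearIndependent_of_det_submatrix_ne_zero {m n S : Type*} [Fintype S] [DecidableEq S]
    (A : Matrix m n ℤ) (r : S → m) (T : Finset n) (g : S ≃ {f // f ∈ T})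
    (h : (A.submatrix r fun i => (g i).1).det ≠ 0) :
    LinearIndependent ℤ fun t : {f // f ∈ T} => Aᵀ t.1 := by
  have hcols := Matrix.linearIndependent_cols_of_det_ne_zero h
  have : LinearIndependent ℤ ((fun t : {f // f ∈ T} => Aᵀ t.1) ∘ g) :=
    LinearIndependent.of_comp (LinearMap.funLeft ℤ ℤ r) hcols
  exact (linearIndependent_equiv g).1 this

theorem det_wLud_submatrix {e : ℕ} (X : CellStructure (e + 1)) {S : Type*} [Fintype S]
    [DecidableEq S] (r : S → Fin (X.c e))
    (g : ∀ T : {T : Finset (Fin (X.c (e + 1))) // T.card = Fintype.card S},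
      S ≃ {f // f ∈ T.1}) :
    (X.wLud.submatrix r r).det =
      ∑ T : {T : Finset (Fin (X.c (e + 1))) // T.card = Fintype.card S},
        (((X.D e).submatrix r fun i => (g T i).1).det :
          MvPolynomial (Fin (X.c (e + 1))) ℤ) ^ 2 * ∏ f ∈ T.1, (MvPolynomial.X f) ^ 2 := by
  have hmul : X.wLud.submatrix r r = X.wD.submatrix r id * (X.wD.submatrix r id)ᵀ := by
    rw [wLud, Matrix.submatrix_mul _ _ r id r Function.bijective_id]
    rfl
  rw [hmul, Matrix.det_mul_eq_sum_det_submatrix _ _ g]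
  refine Finset.sum_congr rfl fun T _ => ?_
  have hcol : ((X.wD.submatrix r id).submatrix id fun i => (g T i).1) =
      ((X.D e).submatrix r fun i => (g T i).1).map
          (Int.castRingHom (MvPolynomial (Fin (X.c (e + 1))) ℤ)) *
        Matrix.diagonal fun i => MvPolynomial.X (g T i).1 := by
    ext1 i j
    simp [wD]
  have hdet : ((X.wD.submatrix r id).submatrix id fun i => (g T i).1).det =
      (((X.D e).submatrix r fun i => (g T i).1).det : MvPolynomial (Fin (X.c (e + 1))) ℤ) *
        ∏ f ∈ T.1, MvPolynomial.X f := by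
    rw [hcol, Matrix.det_mul, Matrix.det_diagonal, ← RingHom.mapMatrix_apply, ← RingHom.map_det,
      eq_intCast, Equiv.prod_comp (g T) fun f => (MvPolynomial.X f.1 : MvPolynomial _ ℤ),
      Finset.prod_coe_sort T.1 fun f => (MvPolynomial.X f : MvPolynomial _ ℤ)]
  have htr : (((X.wD.submatrix r id)ᵀ).submatrix (fun i => (g T i).1) id).det =
      ((X.wD.submatrix r id).submatrix id fun i => (g T i).1).det :=
    Matrix.det_transpose ((X.wD.submatrix r id).submatrix id fun i => (g T i).1)
  rw [htr, hdet, Finset.prod_pow]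
  ring

theorem wtau_mul_index_sq {e : ℕ} (X : CellStructure (e + 1)) {M N : Type*} [AddCommGroup M]
    [AddCommGroup N] [Module ℚ N] (φ : (Fin (X.c e) → ℤ) →ₗ[ℤ] M)
    (ψ : (Fin (X.c e) → ℚ) →ₗ[ℚ] N) (ι : M →ₗ[ℤ] N) (hι : Function.Injective ι)
    (hcomp : ∀ j, ι (φ (Pi.single j 1)) = ψ (Pi.single j 1))
    (hφ : LinearMap.ker φ = X.Zker e) (hψ : LinearMap.ker ψ = X.ZkerQ e)
    (U : Finset (Fin (X.c e)))
    (hli : LinearIndependent ℤ fun t : {f // f ∈ U} => φ (Pi.single t.1 1))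
    (hidx : (Submodule.span ℤ
      ((fun j => φ (Pi.single j 1)) '' (U : Set (Fin (X.c e))))).toAddSubgroup.index ≠ 0) :
    X.wtau * ((Submodule.span ℤ
        ((fun j => φ (Pi.single j 1)) '' (U : Set (Fin (X.c e))))).toAddSubgroup.index :
          MvPolynomial (Fin (X.c (e + 1))) ℤ) ^ 2 =
      ((LinearMap.range φ).toAddSubgroup.index : MvPolynomial (Fin (X.c (e + 1))) ℤ) ^ 2 *
        Matrix.det (X.wLud.submatrix
          (fun i : {f : Fin (X.c e) // f ∉ U} => i.1)
          (fun i : {f : Fin (X.c e) // f ∉ U} => i.1)) := by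
  set P := Submodule.span ℤ ((fun j => φ (Pi.single j 1)) '' (U : Set (Fin (X.c e)))) with hP
  have hdim : Module.finrank ℚ (X.ZkerQ e) = Fintype.card {f // f ∉ U} := by
    rw [← hψ]
    refine finrank_ker_eq_card_compl ψ U ?_ fun j => ⟨P.toAddSubgroup.index, hidx, ?_⟩
    · simp_rw [← hcomp]
      exact hli.map' ι (LinearMap.ker_eq_bot.2 hι)
    · have hmem : P.toAddSubgroup.index • φ (Pi.single j 1) ∈ P :=
        AddSubgroup.nsmul_index_mem P.toAddSubgroup _
      have := Submodule.mem_map_of_mem (f := ι) hmem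
      rw [map_nsmul, hcomp, hP, Submodule.map_span, ← Set.image_comp] at this
      simpa only [Function.comp_def, hcomp] using this
  have hsum : ∀ v, φ v = ∑ j, v j • φ (Pi.single j 1) := fun v => by
    conv_lhs => rw [← Finset.univ_sum_single v, map_sum]
    refine Finset.sum_congr rfl fun j _ => ?_
    rw [← map_smul, ← Pi.single_smul, smul_eq_mul, mul_one]
  let π : (Fin (X.c e) → ℤ) →ₗ[ℤ] ({f // f ∉ U} → ℤ) := LinearMap.funLeft ℤ ℤ Subtype.val
  have hπ : Function.Surjective π :=
    LinearMap.funLeft_surjective_of_injective ℤ ℤ _ Subtype.val_injective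
  have hmemπ : ∀ v, v ∈ LinearMap.ker π ↔ ∀ j, j ∉ U → v j = 0 := fun v => by
    simp [π, LinearMap.mem_ker, funext_iff, LinearMap.funLeft_apply]
  have hmapφ : (LinearMap.ker π).map φ = P := by
    apply le_antisymm
    · rintro _ ⟨v, hv, rfl⟩
      rw [hsum]
      refine Submodule.sum_mem _ fun j _ => ?_
      by_cases hj : j ∈ U
      · exact Submodule.smul_mem _ _ (Submodule.subset_span ⟨j, hj, rfl⟩)
      · rw [(hmemπ v).1 hv j hj, zero_smul]
        exact Submodule.zero_mem _
    · rw [hP, Submodule.span_le]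
      rintro _ ⟨j, hj, rfl⟩
      refine ⟨Pi.single j 1, (hmemπ _).2 fun i hi => ?_, rfl⟩
      exact Pi.single_eq_of_ne (by rintro rfl; exact hi hj) _
  have hdisj : Disjoint φ.toAddMonoidHom.ker π.toAddMonoidHom.ker := by
    rw [AddSubgroup.disjoint_def]
    intro v hvφ hvπ
    have hvφ : φ v = 0 := hvφ
    have hvπ := (hmemπ v).1 hvπ
    rw [hsum, ← Finset.sum_subset U.subset_univ
      (fun j _ hj => by rw [hvπ j hj, zero_smul]), ← Finset.sum_coe_sort] at hvφ
    have hzero := Fintype.linearIndependent_iff.1 hli (fun t => v t.1) hvφ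
    ext j
    by_cases hj : j ∈ U
    · exact hzero ⟨j, hj⟩
    · exact hvπ j hj
  have hle : ∀ T, X.colSpan e T ≤ LinearMap.ker φ := fun T =>
    hφ ▸ X.colSpan_le_Zker e T
  have hindex : ∀ (T : Finset (Fin (X.c (e + 1)))) (g : {f // f ∉ U} ≃ {f // f ∈ T}),
      ((X.D e).submatrix Subtype.val fun i => (g i).1).det.natAbs *
          (LinearMap.range φ).toAddSubgroup.index =
        Nat.card (X.Hsub e T) * P.toAddSubgroup.index := fun T g => by
    have := AddSubgroup.index_map_mul_index_range π.toAddMonoidHom hπ φ.toAddMonoidHom hdisj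
      (X.colSpan e T).toAddSubgroup (hle T)
    rw [card_Hsub_eq_relIndex, ← Matrix.index_range_toLin', ← X.map_colSpan_funLeft e _ T g,
      ← hmapφ, ← hφ]
    exact this
  let g : ∀ T : {T : Finset (Fin (X.c (e + 1))) // T.card = Fintype.card {f // f ∉ U}},
      {f // f ∉ U} ≃ {f // f ∈ T.1} := fun T =>
    Fintype.equivOfCardEq (by rw [Fintype.card_coe, T.2])
  have htree : ∀ T : Finset (Fin (X.c (e + 1))), X.IsTree e T ↔
      T.card = Fintype.card {f // f ∉ U} ∧ Nat.card (X.Hsub e T) ≠ 0 := fun T => by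
    rw [IsTree, hdim]
    refine ⟨fun h => ⟨h.2.2, h.2.1⟩, fun ⟨hT, hcard⟩ => ⟨?_, hcard, hT⟩⟩
    refine linearIndependent_of_det_submatrix_ne_zero (X.D e) Subtype.val T (g ⟨T, hT⟩) ?_
    intro hdet
    have := hindex T (g ⟨T, hT⟩)
    rw [hdet, Int.natAbs_zero, zero_mul] at this
    exact mul_ne_zero hcard hidx this.symm
  have hwtau : X.wtau =
      ∑ T : {T : Finset (Fin (X.c (e + 1))) // T.card = Fintype.card {f // f ∉ U}},
        (Nat.card (X.Hsub e T.1) : MvPolynomial (Fin (X.c (e + 1))) ℤ) ^ 2 *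
          ∏ f ∈ T.1, (MvPolynomial.X f) ^ 2 := by
    classical
    rw [wtau, ← Finset.sum_subtype
      (Finset.univ.filter fun T => T.card = Fintype.card {f // f ∉ U}) (by simp)
      (fun T => (Nat.card (X.Hsub e T) : MvPolynomial (Fin (X.c (e + 1))) ℤ) ^ 2 *
        ∏ f ∈ T, (MvPolynomial.X f) ^ 2), Finset.sum_filter]
    refine Finset.sum_congr rfl fun T _ => ?_
    by_cases hT : T.card = Fintype.card {f // f ∉ U}
    · by_cases hcard : Nat.card (X.Hsub e T) = 0
      · rw [if_neg fun h => ((htree T).1 h).2 hcard, if_pos hT, hcard]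
        simp
      · rw [if_pos ((htree T).2 ⟨hT, hcard⟩), if_pos hT]
    · rw [if_neg fun h => hT ((htree T).1 h).1, if_neg hT]
  rw [hwtau, X.det_wLud_submatrix _ g, Finset.sum_mul, Finset.mul_sum]
  refine Finset.sum_congr rfl fun T _ => ?_
  have hsq : ((Nat.card (X.Hsub e T.1) : ℤ) * P.toAddSubgroup.index) ^ 2 =
      (((X.D e).submatrix Subtype.val fun i => (g T i).1).det *
        (LinearMap.range φ).toAddSubgroup.index) ^ 2 := by
    have := hindex T.1 (g T)
    rw [← Nat.cast_mul, ← this, Nat.cast_mul, mul_pow, Int.natAbs_sq, mul_pow]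
  have hsq' := congrArg (Int.cast : ℤ → MvPolynomial (Fin (X.c (e + 1))) ℤ) hsq
  simp only [Int.cast_pow, Int.cast_mul, Int.cast_natCast] at hsq'
  linear_combination (∏ f ∈ T.1, (MvPolynomial.X f) ^ 2) * hsq'

end CellStructure

/-- **Weighted Cellular Matrix-Tree Theorem, part (2)** (Duval–Klivans–Martin).
Let `U ⊆ X_{d-1}` be the set of `(d-1)`-cells of a cellular spanning `(d-1)`-tree of `X`,
and let `L̂_U` be obtained from `L̂ = ∂̂_d ∂̂_d^T` by deleting the rows and columns indexed
by `U`.  Then `τ̂_d(X) · |H_{d-2}(X_U)|² = |H_{d-2}(X)|² · det L̂_U` in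
`R = ℤ[x_f : f ∈ X_d]`. -/
theorem weighted_cellular_matrix_tree_theorem_part2
    (e : ℕ) (X : CellStructure (e + 1)) (hAPC : X.APC)
    (U : Finset (Fin (X.c e))) (hU : X.IsTreeG e U) :
    X.wtau * (Nat.card (X.HsubG e U) : MvPolynomial (Fin (X.c (e + 1))) ℤ) ^ 2 =
      (Nat.card (X.Hred e) : MvPolynomial (Fin (X.c (e + 1))) ℤ) ^ 2 *
        Matrix.det (X.wLud.submatrix
          (fun i : {f : Fin (X.c e) // f ∉ U} => i.1)
          (fun i : {f : Fin (X.c e) // f ∉ U} => i.1)) := by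
  cases e with
  | zero =>
    have hsingle : ∀ j, X.aug (Pi.single j 1) = 1 := fun j => by simp [CellStructure.aug]
    have := X.wtau_mul_index_sq X.aug X.augQ (Int.castAddHom ℚ).toIntLinearMap
      Int.cast_injective (fun j => by simp [CellStructure.aug, CellStructure.augQ]) rfl rfl
      U (by simpa only [hsingle] using hU.1) (by simp only [hsingle]; exact hU.2.1)
    simp only [hsingle] at this
    exact this
  | succ k =>
    let φ := (X.bdry k).codRestrict (X.Zker k) (X.bdry_mem_Zker k)
    let ι : X.Zker k →ₗ[ℤ] (Fin (X.c k) → ℚ) :=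
      ((Int.castAddHom ℚ).toIntLinearMap.compLeft (Fin (X.c k))) ∘ₗ (X.Zker k).subtype
    have hval : ∀ j, (φ (Pi.single j 1) : Fin (X.c k) → ℤ) = (X.D k)ᵀ j := X.bdry_single k
    have hspan : Submodule.span ℤ ((fun j => φ (Pi.single j 1)) '' (U : Set (Fin (X.c (k + 1))))) =
        (X.colSpan k U).comap (X.Zker k).subtype := by
      apply Submodule.map_injective_of_injective (X.Zker k).injective_subtype
      rw [Submodule.map_span, ← Set.image_comp, Submodule.map_comap_subtype,
        inf_eq_right.2 (X.colSpan_le_Zker k U), CellStructure.colSpan]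
      simp only [Function.comp_def, Submodule.subtype_apply, hval]
    have hrange : LinearMap.range φ =
        (LinearMap.range (X.bdry k)).comap (X.Zker k).subtype := LinearMap.range_codRestrict ..
    have := X.wtau_mul_index_sq φ (Matrix.toLin' ((X.D k).map (Int.cast : ℤ → ℚ))) ι
      (fun a b h => by
        ext i
        have := congrFun h i
        simpa [ι] using this)
      (fun j => by
        ext i
        have := congrFun (hval j) i
        simp [ι, this])
      (LinearMap.ker_codRestrict _ _ _) rfl U
      (by
        apply LinearIndependent.of_comp (X.Zker k).subtype
        simpa only [Function.comp_def, Submodule.subtype_apply, hval] using hU.1)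
      (by
        rw [hspan]
        exact hU.2.1)
    rw [hspan, hrange] at this
    exact this
end
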